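/- arXiv:2408.15648 — 2 statements merged into one kernel-verified Lean document; each statement's English description precedes it below -/
import Mathlib

section
/- Fix an integer d ≥ 2, an index n ∈ {1,…,2d+2}, and a finite (possibly empty) set Σ of primes. Let V_Σ := {C ∈ 𝒫 : p does not divide 𝔯(C) for every p ∈ Σ, and p^d does not divide 𝔯(C) for every prime p} (i.e., rational maps of degree d with d-power-free resultant and good reduction at all primes in Σ). Then the n-th weak box density μ_n(V_Σ) exists and is strictly positive. -/
open Filter MvPolynomial

noncomputable section

/-- The `2d × 2d` Sylvester matrix of the two generic binary forms of degree `d`,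
with entries taken from the coordinates of `Q` (the first `d+1` coordinates of `Q`
are the coefficients of `F`, the last `d+1` ones those of `G`). -/
def sylvesterMat (d : ℕ) {R : Type*} [CommRing R] (Q : Fin (2 * d + 2) → R) :
    Matrix (Fin (2 * d)) (Fin (2 * d)) R :=
  Matrix.of fun i j =>
    if hi : (i : ℕ) < d then
      if h : (i : ℕ) ≤ (j : ℕ) ∧ (j : ℕ) ≤ (i : ℕ) + d then
        Q ⟨(j : ℕ) - (i : ℕ), by omega⟩
      else 0
    else
      if h : (i : ℕ) - d ≤ (j : ℕ) ∧ (j : ℕ) ≤ (i : ℕ) then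
        Q ⟨d + 1 + ((j : ℕ) - ((i : ℕ) - d)), by omega⟩
      else 0

/-- The generic resultant polynomial `𝔯 ∈ ℤ[x₀,…,x_d,y₀,…,y_d]`:
the determinant of the Sylvester matrix of the generic binary forms of degree `d`. -/
def resPoly (d : ℕ) : MvPolynomial (Fin (2 * d + 2)) ℤ :=
  Matrix.det (sylvesterMat d fun i => X i)

/-- Evaluation `𝔯(Q)` of the generic resultant at a tuple `Q` with entries in a
commutative ring (i.e. evaluation of the image of `𝔯` under the coefficient map `ℤ → R`). -/
def resEval (d : ℕ) {R : Type*} [CommRing R] (Q : Fin (2 * d + 2) → R) : R :=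
  aeval Q (resPoly d)

/-- The set `𝒫 ⊆ ℤ^{2d+2}` identified with `ℙ^{2d+1}(ℚ)`: integer tuples with gcd `1`
whose first nonzero coordinate is positive. -/
def projPts (d : ℕ) : Set (Fin (2 * d + 2) → ℤ) :=
  {C | Finset.univ.gcd C = 1 ∧ ∃ i, 0 < C i ∧ ∀ j, j < i → C j = 0}

/-- The box of integer tuples with `|xᵢ| ≤ rᵢ` for all `i`. -/
def box {m : ℕ} (r : Fin m → ℝ) : Set (Fin m → ℤ) :=
  {x | ∀ i, |(x i : ℝ)| ≤ r i}

/-- The value `ζ(k)` of the Riemann zeta function at an integer `k` (for `k ≥ 2`). -/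
def zetaVal (k : ℕ) : ℝ := ∑' n : ℕ+, (1 : ℝ) / ((n : ℕ) : ℝ) ^ k

/-- The local factor `π_p^{(k)}`. -/
def piLocal (d p k : ℕ) : ℝ :=
  (Nat.card {Q : Fin (2 * d + 2) → ZMod (p ^ k) // resEval d Q ≠ 0} : ℝ) /
    ((p : ℝ) ^ ((2 * d + 2) * k) * (1 - 1 / (p : ℝ) ^ (2 * d + 2)))

/-- The set `V_Σ`: tuples in `𝒫` with `d`-power free resultant and resultant
not divisible by any `p ∈ Σ` (good reduction at `Σ`). -/
def VSigma (d : ℕ) (Sig : Finset ℕ) : Set (Fin (2 * d + 2) → ℤ) :=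
  {C | C ∈ projPts d ∧ (∀ p ∈ Sig, ¬ (p : ℤ) ∣ resEval d C) ∧
    ∀ p : ℕ, p.Prime → ¬ (p : ℤ) ^ d ∣ resEval d C}

/-- The ratio `#S(r⃗)/#𝒫(r⃗)` entering the weak box densities. -/
def weakRatio (d : ℕ) (S : Set (Fin (2 * d + 2) → ℤ)) (r : Fin (2 * d + 2) → ℝ) : ℝ :=
  (Nat.card ↥(S ∩ box r) : ℝ) / (Nat.card ↥(projPts d ∩ box r) : ℝ)

/-! ### Counting in integer boxes -/

/-- The finset of integer points of the box `∏ [-rᵢ, rᵢ]`. -/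
noncomputable def intBox {ι : Type*} [Fintype ι] [DecidableEq ι] (r : ι → ℕ) : Finset (ι → ℤ) :=
  Fintype.piFinset fun i => Finset.Icc (-(r i : ℤ)) (r i)

lemma mem_intBox {ι : Type*} [Fintype ι] [DecidableEq ι] {r : ι → ℕ} {x : ι → ℤ} :
    x ∈ intBox r ↔ ∀ i, |x i| ≤ r i := by
  simp [intBox, abs_le]

lemma card_Icc_neg (M : ℕ) : (Finset.Icc (-(M : ℤ)) M).card = 2 * M + 1 := by
  rw [Int.card_Icc]; omega

lemma card_intBox {ι : Type*} [Fintype ι] [DecidableEq ι] (r : ι → ℕ) :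
    (intBox r).card = ∏ i, (2 * r i + 1) := by
  simp only [intBox, Fintype.card_piFinset, card_Icc_neg]

lemma card_intBox_pos {ι : Type*} [Fintype ι] [DecidableEq ι] (r : ι → ℕ) :
    0 < ((intBox r).card : ℝ) := by
  rw [card_intBox]; exact_mod_cast Finset.prod_pos fun i _ => by omega

lemma sum_intBox_insertNth {m : ℕ} (v : Fin (m + 1)) (s : Fin m → ℕ) (M : ℕ)
    (F : (Fin (m + 1) → ℤ) → ℝ) :
    ∑ x ∈ intBox (Fin.insertNth v M s : Fin (m + 1) → ℕ), F x =
      ∑ c ∈ intBox s, ∑ t ∈ Finset.Icc (-(M : ℤ)) M, F (Fin.insertNth v t c) := by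
  rw [← Finset.sum_product']
  refine Finset.sum_bij' (fun x _ => (v.removeNth x, x v))
    (fun y _ => (Fin.insertNth v y.2 y.1 : Fin (m + 1) → ℤ)) ?_ ?_ ?_ ?_ ?_
  · intro x hx
    rw [mem_intBox] at hx
    have h1 := hx v
    simp only [Fin.insertNth_apply_same, abs_le] at h1
    simp only [Finset.mem_product, mem_intBox, Finset.mem_Icc]
    refine ⟨fun i => ?_, h1⟩
    simpa [Fin.removeNth] using hx (v.succAbove i)
  · intro y hy
    simp only [Finset.mem_product, mem_intBox, Finset.mem_Icc] at hy
    rw [mem_intBox]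
    intro i
    refine Fin.succAboveCases v ?_ (fun j => ?_) i
    · simpa [abs_le] using hy.2
    · simpa using hy.1 j
  · intro x _; simp
  · intro y _; simp
  · intro x _; simp

lemma card_intBox_insertNth {m : ℕ} (v : Fin (m + 1)) (s : Fin m → ℕ) (M : ℕ) :
    ((intBox (Fin.insertNth v M s : Fin (m + 1) → ℕ)).card : ℝ) =
      (intBox s).card * (2 * M + 1) := by
  have := sum_intBox_insertNth v s M (fun _ => 1)
  simp only [Finset.sum_const, card_Icc_neg] at this
  push_cast [nsmul_eq_mul, mul_one] at this
  exact this

lemma abs_card_modEq_sub_le (M q : ℕ) (hq : 0 < q) (a : ℤ) :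
    |((((Finset.Icc (-(M : ℤ)) M).filter fun t => t ≡ a [ZMOD q]).card : ℝ) -
      (2 * M + 1) / q)| ≤ 1 := by
  have h := Int.Ioc_filter_modEq_card (-(M : ℤ) - 1) (M : ℤ) (r := (q : ℤ)) (by exact_mod_cast hq) a
  have e : Finset.Ioc (-(M : ℤ) - 1) M = Finset.Icc (-(M : ℤ)) M := by
    ext x; simp only [Finset.mem_Ioc, Finset.mem_Icc]; omega
  rw [e] at h
  have hq' : (0 : ℚ) < q := by exact_mod_cast hq
  set c := ((Finset.Icc (-(M : ℤ)) M).filter fun t => t ≡ a [ZMOD q]).card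
  have key : |((c : ℚ) - (2 * (M : ℚ) + 1) / (q : ℚ))| ≤ 1 := by
    set A : ℚ := ((M : ℤ) - a) / ((q : ℤ) : ℚ) with hA
    set B : ℚ := (((-(M : ℤ) - 1 : ℤ) : ℚ) - a) / ((q : ℤ) : ℚ) with hB
    have hAB : A - B = (2 * M + 1) / q := by
      rw [hA, hB]; push_cast; field_simp; ring
    have hle : B ≤ A := by
      have : 0 ≤ A - B := by rw [hAB]; positivity
      linarith
    have hfl : ⌊B⌋ ≤ ⌊A⌋ := Int.floor_le_floor hle
    rw [max_eq_left (by linarith)] at h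
    have hc : (c : ℚ) = ⌊A⌋ - ⌊B⌋ := by exact_mod_cast h
    rw [hc, ← hAB, abs_le]
    have := Int.floor_le A; have := Int.floor_le B
    have := Int.lt_floor_add_one A; have := Int.lt_floor_add_one B
    constructor <;> linarith
  have key' : ((|((c : ℚ) - (2 * (M : ℚ) + 1) / (q : ℚ))| : ℚ) : ℝ) ≤ ((1 : ℚ) : ℝ) :=
    Rat.cast_le.2 key
  push_cast at key'
  exact key'

lemma card_modEq_le (M q : ℕ) (hq : 0 < q) (a : ℤ) :
    (((Finset.Icc (-(M : ℤ)) M).filter fun t => t ≡ a [ZMOD q]).card : ℝ) ≤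
      (2 * M + 1) / q + 1 := by
  have := (abs_le.1 (abs_card_modEq_sub_le M q hq a)).2
  linarith

lemma card_residues_le (M q k : ℕ) (hq : 0 < q) (A : Finset (ZMod q)) (hA : A.card ≤ k) :
    (((Finset.Icc (-(M : ℤ)) M).filter fun t : ℤ => (t : ZMod q) ∈ A).card : ℝ) ≤
      k * ((2 * M + 1) / q + 1) := by
  have : NeZero q := ⟨hq.ne'⟩
  have hsub : ((Finset.Icc (-(M : ℤ)) M).filter fun t : ℤ => (t : ZMod q) ∈ A) ⊆
      A.biUnion fun a => (Finset.Icc (-(M : ℤ)) M).filter fun t => t ≡ (a.val : ℤ) [ZMOD q] := by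
    intro t ht
    simp only [Finset.mem_filter, Finset.mem_biUnion] at ht ⊢
    refine ⟨t, ht.2, ht.1, ?_⟩
    rw [← ZMod.intCast_eq_intCast_iff]
    simp
  calc _ ≤ ((∑ a ∈ A, ((Finset.Icc (-(M : ℤ)) M).filter
          fun t => t ≡ (a.val : ℤ) [ZMOD q]).card : ℕ) : ℝ) := by
        exact_mod_cast (Finset.card_le_card hsub).trans Finset.card_biUnion_le
    _ ≤ ∑ a ∈ A, ((2 * M + 1) / q + 1 : ℝ) := by
        push_cast
        exact Finset.sum_le_sum fun a _ => card_modEq_le M q hq _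
    _ = A.card * ((2 * M + 1) / q + 1 : ℝ) := by rw [Finset.sum_const, nsmul_eq_mul]
    _ ≤ _ := by gcongr

/-- The number of roots modulo `p` of an integer polynomial not vanishing modulo `p`. -/
lemma card_dvd_eval_le (M p k : ℕ) (hp : p.Prime) (g : Polynomial ℤ) (hk : g.natDegree ≤ k)
    (hg : g.map (Int.castRingHom (ZMod p)) ≠ 0) :
    (((Finset.Icc (-(M : ℤ)) M).filter fun t => (p : ℤ) ∣ g.eval t).card : ℝ) ≤
      k * ((2 * M + 1) / p + 1) := by
  classical
  have : Fact p.Prime := ⟨hp⟩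
  refine le_trans ?_ (card_residues_le M p k hp.pos
    (g.map (Int.castRingHom (ZMod p))).roots.toFinset ?_)
  · gcongr with t
    intro h
    rw [Multiset.mem_toFinset, Polynomial.mem_roots hg, Polynomial.IsRoot]
    rw [← eq_intCast (Int.castRingHom (ZMod p)) t, Polynomial.eval_map_apply, eq_intCast]
    exact (ZMod.intCast_zmod_eq_zero_iff_dvd _ _).2 h
  · exact ((Multiset.toFinset_card_le _).trans (Polynomial.card_roots' _)).trans
      (Polynomial.natDegree_map_le.trans hk)

lemma card_eval_eq_zero_le (M k : ℕ) (g : Polynomial ℤ) (hk : g.natDegree ≤ k) (hg : g ≠ 0) :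
    (((Finset.Icc (-(M : ℤ)) M).filter fun t => g.eval t = 0).card : ℝ) ≤ k := by
  classical
  have : ((Finset.Icc (-(M : ℤ)) M).filter fun t => g.eval t = 0) ⊆ g.roots.toFinset := by
    intro t ht
    rw [Multiset.mem_toFinset, Polynomial.mem_roots hg]
    exact (Finset.mem_filter.1 ht).2
  exact_mod_cast (Finset.card_le_card this).trans
    (((Multiset.toFinset_card_le _).trans (Polynomial.card_roots' _)).trans hk)

/-- A root modulo `p ^ d` is determined by its residue modulo `p` when it is simple. -/
lemma card_pow_dvd_eval_le (M p k d : ℕ) (hd : d ≠ 0) (hp : p.Prime) (g U V : Polynomial ℤ) (a : ℤ)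
    (hk : g.natDegree ≤ k) (hUV : U * g + V * g.derivative = Polynomial.C a)
    (ha : ¬ (p : ℤ) ∣ a) :
    (((Finset.Icc (-(M : ℤ)) M).filter fun t => (p : ℤ) ^ d ∣ g.eval t).card : ℝ) ≤
      k * ((2 * M + 1) / (p : ℝ) ^ d + 1) := by
  classical
  have hF : Fact p.Prime := ⟨hp⟩
  have hpd : 0 < p ^ d := pow_pos hp.pos d
  have : NeZero (p ^ d) := ⟨hpd.ne'⟩
  have hdvd : p ∣ p ^ d := dvd_pow_self p hd
  set g' := g.map (Int.castRingHom (ZMod p)) with hg'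
  have hg : g' ≠ 0 := by
    intro h
    have h2 := congrArg (Polynomial.map (Int.castRingHom (ZMod p))) hUV
    rw [Polynomial.map_add, Polynomial.map_mul, Polynomial.map_mul, ← Polynomial.derivative_map,
      ← hg', h] at h2
    simp only [mul_zero, Polynomial.derivative_zero, add_zero, Polynomial.map_C] at h2
    have h3 := Polynomial.C_eq_zero.1 h2.symm
    exact ha ((ZMod.intCast_zmod_eq_zero_iff_dvd _ _).1 (by simpa using h3))
  set A : Finset (ZMod (p ^ d)) :=
    Finset.univ.filter fun x => (p : ℤ) ^ d ∣ g.eval (x.val : ℤ) with hA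
  have hcast : ∀ t : ℤ, (p : ℤ) ∣ g.eval t → ((t : ZMod p)) ∈ g'.roots.toFinset := by
    intro t h
    rw [Multiset.mem_toFinset, Polynomial.mem_roots hg, Polynomial.IsRoot]
    rw [hg', ← eq_intCast (Int.castRingHom (ZMod p)) t, Polynomial.eval_map_apply, eq_intCast]
    exact (ZMod.intCast_zmod_eq_zero_iff_dvd _ _).2 h
  have hcard : A.card ≤ k := by
    have h1 : A.card ≤ g'.roots.toFinset.card := by
      refine Finset.card_le_card_of_injOn (fun x => ((x.val : ℤ) : ZMod p)) ?_ ?_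
      · intro x hx
        have hx' := (Finset.mem_filter.1 hx).2
        exact hcast _ ((dvd_pow_self (p : ℤ) hd).trans hx')
      · intro x hx y hy hxy
        have hx' := (Finset.mem_filter.1 hx).2
        have hy' := (Finset.mem_filter.1 hy).2
        obtain ⟨w, hw⟩ := g.binomExpansion (x.val : ℤ) ((y.val : ℤ) - x.val)
        have hpxy : (p : ℤ) ∣ (y.val : ℤ) - x.val := by
          have := (ZMod.intCast_eq_intCast_iff_dvd_sub _ _ _).1 hxy
          simpa using this
        have e1 : (x.val : ℤ) + (y.val - x.val) = y.val := by ring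
        rw [e1] at hw
        have hfac : (p : ℤ) ^ d ∣ ((y.val : ℤ) - x.val) *
            (g.derivative.eval (x.val : ℤ) + w * ((y.val : ℤ) - x.val)) := by
          have : ((y.val : ℤ) - x.val) *
            (g.derivative.eval (x.val : ℤ) + w * ((y.val : ℤ) - x.val)) =
            g.eval (y.val : ℤ) - g.eval (x.val : ℤ) := by rw [hw]; ring
          rw [this]; exact dvd_sub hy' hx'
        have hnd : ¬ (p : ℤ) ∣ g.derivative.eval (x.val : ℤ) + w * ((y.val : ℤ) - x.val) := by
          intro h
          have h4 : (p : ℤ) ∣ g.derivative.eval (x.val : ℤ) :=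
            (dvd_add_left (hpxy.mul_left w)).1 h
          have h5 := congrArg (Polynomial.eval (x.val : ℤ)) hUV
          simp only [Polynomial.eval_add, Polynomial.eval_mul, Polynomial.eval_C] at h5
          apply ha
          rw [← h5]
          exact dvd_add (((dvd_pow_self (p : ℤ) hd).trans hx').mul_left _) (h4.mul_left _)
        have hcop : IsCoprime ((p : ℤ) ^ d)
            (g.derivative.eval (x.val : ℤ) + w * ((y.val : ℤ) - x.val)) :=
          ((Nat.prime_iff_prime_int.1 hp).coprime_iff_not_dvd.2 hnd).pow_left
        have h6 := hcop.dvd_of_dvd_mul_right hfac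
        have h7 : ((x.val : ℤ) : ZMod (p ^ d)) = ((y.val : ℤ) : ZMod (p ^ d)) := by
          rw [ZMod.intCast_eq_intCast_iff_dvd_sub]
          exact_mod_cast h6
        simpa using h7
    exact h1.trans (((Multiset.toFinset_card_le _).trans (Polynomial.card_roots' _)).trans
      (Polynomial.natDegree_map_le.trans hk))
  have := card_residues_le M (p ^ d) k hpd A hcard
  push_cast at this
  refine le_trans ?_ this
  gcongr with t
  intro h
  rw [hA, Finset.mem_filter]
  refine ⟨Finset.mem_univ _, ?_⟩
  have h8 : (((t : ZMod (p ^ d)).val : ℤ) : ZMod (p ^ d)) = (t : ZMod (p ^ d)) := by simp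
  have h9 : ((p ^ d : ℕ) : ℤ) ∣ t - ((t : ZMod (p ^ d)).val : ℤ) :=
    (ZMod.intCast_eq_intCast_iff_dvd_sub _ _ _).1 h8
  have h10 : (t - ((t : ZMod (p ^ d)).val : ℤ)) ∣ g.eval t - g.eval ((t : ZMod (p ^ d)).val : ℤ) :=
    Polynomial.sub_dvd_eval_sub _ _ _
  push_cast at h9
  exact (dvd_sub_right h).1 (h9.trans h10)

/-! ### Average size of the sum of reciprocals of large prime divisors -/

/-- The sum of `1 / p` over the prime divisors `p > z` of `a`. -/
def primeRecipSum (z : ℕ) (a : ℤ) : ℝ :=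
  ∑ p ∈ a.natAbs.primeFactors.filter (z < ·), (p : ℝ)⁻¹

/-- The truncation at `1` of `primeRecipSum`, with value `1` at `a = 0`. -/
def truncRecipSum (z : ℕ) (a : ℤ) : ℝ := if a = 0 then 1 else min 1 (primeRecipSum z a)

lemma primeRecipSum_nonneg (z : ℕ) (a : ℤ) : 0 ≤ primeRecipSum z a :=
  Finset.sum_nonneg fun _ _ => by positivity

lemma truncRecipSum_nonneg (z : ℕ) (a : ℤ) : 0 ≤ truncRecipSum z a := by
  unfold truncRecipSum; split_ifs
  · exact zero_le_one
  · exact le_min zero_le_one (primeRecipSum_nonneg z a)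

lemma truncRecipSum_le_one (z : ℕ) (a : ℤ) : truncRecipSum z a ≤ 1 := by
  unfold truncRecipSum; split_ifs
  · exact le_rfl
  · exact min_le_left _ _

lemma sum_inv_sq_le (z M : ℕ) (hz : z ≠ 0) :
    ∑ p ∈ Finset.Ioc z M, ((p : ℝ) ^ 2)⁻¹ ≤ (z : ℝ)⁻¹ := by
  rcases le_total z M with h | h
  · have := sum_Ioc_inv_sq_le_sub (α := ℝ) hz h
    have h2 : (0 : ℝ) ≤ (M : ℝ)⁻¹ := by positivity
    linarith
  · rw [Finset.Ioc_eq_empty_of_le h]; simp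

lemma card_large_primeFactors_le (M C D N : ℕ) (hM : 1 ≤ M) (hC : C ≤ M) (hN : N ≠ 0)
    (hle : N ≤ C * M ^ D) : (N.primeFactors.filter (M < ·)).card ≤ D + 1 := by
  have h1 : (M + 1) ^ (N.primeFactors.filter (M < ·)).card ≤ N := by
    calc (M + 1) ^ (N.primeFactors.filter (M < ·)).card
        ≤ ∏ p ∈ N.primeFactors.filter (M < ·), p :=
          Finset.pow_card_le_prod _ _ _ fun p hp => (Finset.mem_filter.1 hp).2
      _ ≤ ∏ p ∈ N.primeFactors, p :=
          Finset.prod_le_prod_of_subset_of_one_le' (Finset.filter_subset _ _)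
            fun p hp _ => (Nat.prime_of_mem_primeFactors hp).one_le
      _ ≤ N := Nat.le_of_dvd (Nat.pos_of_ne_zero hN) (Nat.prod_primeFactors_dvd N)
  have h2 : N ≤ (M + 1) ^ (D + 1) := by
    calc N ≤ M * M ^ D := hle.trans (Nat.mul_le_mul_right _ hC)
      _ = M ^ (D + 1) := by ring
      _ ≤ _ := Nat.pow_le_pow_left (Nat.le_succ M) _
  exact (Nat.pow_le_pow_iff_right (by omega)).1 (h1.trans h2)

lemma map_castRingHom_ne_zero_of_not_dvd (p : ℕ) (g : Polynomial ℤ) (k : ℕ)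
    (h : ¬ (p : ℤ) ∣ g.coeff k) : g.map (Int.castRingHom (ZMod p)) ≠ 0 := by
  intro h0
  apply h
  have := congrArg (fun f => Polynomial.coeff f k) h0
  simp only [Polynomial.coeff_map, Polynomial.coeff_zero, eq_intCast] at this
  exact (ZMod.intCast_zmod_eq_zero_iff_dvd _ _).1 this

lemma truncRecipSum_eval_le (z M k C D : ℕ) (g : Polynomial ℤ) (hM : 1 ≤ M)
    (hC : C ≤ M) (hk : g.coeff k ≠ 0) (t : ℤ) (hb : |g.eval t| ≤ C * (M : ℤ) ^ D) :
    truncRecipSum z (g.eval t) ≤ (if g.eval t = 0 then 1 else 0) +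
      primeRecipSum z (g.coeff k) +
      ∑ p ∈ (Finset.Ioc z M).filter fun p : ℕ => p.Prime ∧ ¬ (p : ℤ) ∣ g.coeff k,
        (if (p : ℤ) ∣ g.eval t then (p : ℝ)⁻¹ else 0) + (D + 1) / M := by
  have hpos : (0 : ℝ) ≤ ∑ p ∈ (Finset.Ioc z M).filter fun p : ℕ => p.Prime ∧ ¬ (p : ℤ) ∣ g.coeff k,
        (if (p : ℤ) ∣ g.eval t then (p : ℝ)⁻¹ else 0) :=
    Finset.sum_nonneg fun p _ => by split_ifs <;> positivity
  have hpos2 : (0 : ℝ) ≤ ((D : ℝ) + 1) / M := by positivity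
  have hpos3 := primeRecipSum_nonneg z (g.coeff k)
  by_cases h0 : g.eval t = 0
  · rw [if_pos h0]
    linarith [truncRecipSum_le_one z (g.eval t)]
  rw [if_neg h0, truncRecipSum, if_neg h0, zero_add]
  refine (min_le_right _ _).trans ?_
  set N := (g.eval t).natAbs with hN
  have hN0 : N ≠ 0 := by simpa [hN] using h0
  set P1 := (g.coeff k).natAbs.primeFactors.filter (z < ·)
  set P2 := ((Finset.Ioc z M).filter fun p : ℕ => p.Prime ∧ ¬ (p : ℤ) ∣ g.coeff k).filter
    fun p : ℕ => (p : ℤ) ∣ g.eval t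
  set P3 := N.primeFactors.filter (M < ·)
  have hsub : N.primeFactors.filter (z < ·) ⊆ P1 ∪ P2 ∪ P3 := by
    intro p hp
    obtain ⟨hp1, hp2⟩ := Finset.mem_filter.1 hp
    have hpp := Nat.prime_of_mem_primeFactors hp1
    have hpd : (p : ℤ) ∣ g.eval t := Int.natCast_dvd.2 (Nat.dvd_of_mem_primeFactors hp1)
    simp only [Finset.mem_union]
    by_cases hpM : M < p
    · exact Or.inr (Finset.mem_filter.2 ⟨hp1, hpM⟩)
    by_cases hpa : (p : ℤ) ∣ g.coeff k
    · refine Or.inl (Or.inl (Finset.mem_filter.2 ⟨?_, hp2⟩))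
      exact Nat.mem_primeFactors.2 ⟨hpp, Int.natCast_dvd.1 hpa, by simpa using hk⟩
    · refine Or.inl (Or.inr ?_)
      simp only [P2, Finset.mem_filter, Finset.mem_Ioc]
      exact ⟨⟨⟨hp2, not_lt.1 hpM⟩, hpp, hpa⟩, hpd⟩
  have hnn : ∀ S : Finset ℕ, 0 ≤ ∑ p ∈ S, (p : ℝ)⁻¹ := fun S =>
    Finset.sum_nonneg fun _ _ => by positivity
  have hun : ∀ S T : Finset ℕ, ∑ p ∈ S ∪ T, (p : ℝ)⁻¹ ≤ ∑ p ∈ S, (p : ℝ)⁻¹ + ∑ p ∈ T, (p : ℝ)⁻¹ := by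
    intro S T
    rw [← Finset.sum_union_inter]
    linarith [hnn (S ∩ T)]
  have h3 : ∑ p ∈ P3, (p : ℝ)⁻¹ ≤ (D + 1) / M := by
    have hcard := card_large_primeFactors_le M C D N hM hC hN0 (by
      have : (N : ℤ) ≤ C * (M : ℤ) ^ D := by rw [hN, Int.natCast_natAbs]; exact hb
      exact_mod_cast this)
    calc ∑ p ∈ P3, (p : ℝ)⁻¹ ≤ ∑ p ∈ P3, (M : ℝ)⁻¹ := by
          refine Finset.sum_le_sum fun p hp => ?_
          have : M < p := (Finset.mem_filter.1 hp).2
          have hM' : (0 : ℝ) < M := by exact_mod_cast hM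
          exact inv_anti₀ hM' (by exact_mod_cast this.le)
      _ = P3.card / M := by rw [Finset.sum_const, nsmul_eq_mul]; rfl
      _ ≤ _ := by
          gcongr
          exact_mod_cast hcard
  have h2 : ∑ p ∈ P2, (p : ℝ)⁻¹ =
      ∑ p ∈ (Finset.Ioc z M).filter fun p : ℕ => p.Prime ∧ ¬ (p : ℤ) ∣ g.coeff k,
        (if (p : ℤ) ∣ g.eval t then (p : ℝ)⁻¹ else 0) := Finset.sum_filter _ _
  rw [← h2]
  calc primeRecipSum z (g.eval t) ≤ ∑ p ∈ P1 ∪ P2 ∪ P3, (p : ℝ)⁻¹ :=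
        Finset.sum_le_sum_of_subset_of_nonneg hsub fun _ _ _ => by positivity
    _ ≤ ∑ p ∈ P1, (p : ℝ)⁻¹ + ∑ p ∈ P2, (p : ℝ)⁻¹ + ∑ p ∈ P3, (p : ℝ)⁻¹ := by
        linarith [hun (P1 ∪ P2) P3, hun P1 P2]
    _ ≤ _ := by
        have : ∑ p ∈ P1, (p : ℝ)⁻¹ = primeRecipSum z (g.coeff k) := rfl
        linarith

/-- One-variable step: averaging `truncRecipSum` over the values of a polynomial. -/
lemma sum_truncRecipSum_eval_le (z M k C D : ℕ) (g : Polynomial ℤ) (hz : 1 ≤ z) (hM : 1 ≤ M)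
    (hC : C ≤ M) (hk : g.natDegree ≤ k)
    (hb : ∀ t ∈ Finset.Icc (-(M : ℤ)) M, |g.eval t| ≤ C * (M : ℤ) ^ D) :
    ∑ t ∈ Finset.Icc (-(M : ℤ)) M, truncRecipSum z (g.eval t) ≤
      (truncRecipSum z (g.coeff k) + (k / M + 2 * k / z + (D + 1) / M)) * (2 * M + 1) := by
  have hM' : (0 : ℝ) < M := by exact_mod_cast hM
  have hz' : (0 : ℝ) < z := by exact_mod_cast hz
  by_cases h1 : truncRecipSum z (g.coeff k) = 1
  · rw [h1]
    calc _ ≤ ∑ t ∈ Finset.Icc (-(M : ℤ)) M, (1 : ℝ) :=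
          Finset.sum_le_sum fun t _ => truncRecipSum_le_one z _
      _ = 1 * (2 * M + 1) := by
          rw [Finset.sum_const, card_Icc_neg, nsmul_eq_mul]; push_cast; ring
      _ ≤ _ := by
          gcongr
          have : (0 : ℝ) ≤ k / M + 2 * k / z + (D + 1) / M := by positivity
          linarith
  have hne : g.coeff k ≠ 0 := fun h => h1 (by simp [truncRecipSum, h])
  have hS : truncRecipSum z (g.coeff k) = primeRecipSum z (g.coeff k) := by
    rw [truncRecipSum, if_neg hne] at h1 ⊢
    exact min_eq_right (le_of_not_ge fun h => h1 (min_eq_left h))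
  have hg0 : g ≠ 0 := fun h => hne (by simp [h])
  rw [hS]
  refine (Finset.sum_le_sum fun t ht =>
    truncRecipSum_eval_le z M k C D g hM hC hne t (hb t ht)).trans ?_
  simp only [Finset.sum_add_distrib]
  have e1 : ∑ t ∈ Finset.Icc (-(M : ℤ)) M, (if g.eval t = 0 then (1 : ℝ) else 0) ≤
      k / M * (2 * M + 1) := by
    rw [Finset.sum_boole]
    calc _ ≤ (k : ℝ) := card_eval_eq_zero_le M k g hk hg0
      _ = k / M * M := by field_simp
      _ ≤ _ := by gcongr; linarith
  have e2 : ∀ a : ℝ, ∑ _t ∈ Finset.Icc (-(M : ℤ)) M, a = a * (2 * M + 1) := by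
    intro a
    rw [Finset.sum_const, card_Icc_neg, nsmul_eq_mul]; push_cast; ring
  have e3 : ∑ t ∈ Finset.Icc (-(M : ℤ)) M,
      ∑ p ∈ (Finset.Ioc z M).filter fun p : ℕ => p.Prime ∧ ¬ (p : ℤ) ∣ g.coeff k,
        (if (p : ℤ) ∣ g.eval t then (p : ℝ)⁻¹ else 0) ≤ 2 * k / z * (2 * M + 1) := by
    rw [Finset.sum_comm]
    calc _ ≤ ∑ p ∈ (Finset.Ioc z M).filter fun p : ℕ => p.Prime ∧ ¬ (p : ℤ) ∣ g.coeff k,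
          2 * k * (2 * M + 1) * ((p : ℝ) ^ 2)⁻¹ := by
          refine Finset.sum_le_sum fun p hp => ?_
          simp only [Finset.mem_filter, Finset.mem_Ioc] at hp
          obtain ⟨⟨_, hpM⟩, hpp, hpa⟩ := hp
          have hp0 : (0 : ℝ) < p := by exact_mod_cast hpp.pos
          have hpM' : (p : ℝ) ≤ M := by exact_mod_cast hpM
          have hcount := card_dvd_eval_le M p k hpp g hk
            (map_castRingHom_ne_zero_of_not_dvd p g k hpa)
          have hle : (1 : ℝ) ≤ (2 * M + 1) / p := by
            rw [le_div_iff₀ hp0]; linarith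
          rw [← Finset.sum_filter, Finset.sum_const, nsmul_eq_mul]
          calc _ ≤ (k * ((2 * M + 1) / p + 1) : ℝ) * (p : ℝ)⁻¹ := by gcongr
            _ ≤ (k * ((2 * M + 1) / p + (2 * M + 1) / p) : ℝ) * (p : ℝ)⁻¹ := by gcongr
            _ = _ := by field_simp; ring
      _ ≤ ∑ p ∈ Finset.Ioc z M, 2 * k * (2 * M + 1) * ((p : ℝ) ^ 2)⁻¹ :=
          Finset.sum_le_sum_of_subset_of_nonneg (Finset.filter_subset _ _)
            fun _ _ _ => by positivity
      _ = 2 * k * (2 * M + 1) * ∑ p ∈ Finset.Ioc z M, ((p : ℝ) ^ 2)⁻¹ := by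
          rw [Finset.mul_sum]
      _ ≤ 2 * k * (2 * M + 1) * (z : ℝ)⁻¹ := by
          gcongr; exact sum_inv_sq_le z M (by omega)
      _ = _ := by field_simp
  rw [e2, e2]
  linarith

/-- Polynomial growth of the values of an integer polynomial on boxes. -/
lemma exists_abs_eval_le {σ : Type*} (P : MvPolynomial σ ℤ) :
    ∃ C D : ℕ, ∀ (M : ℕ) (x : σ → ℤ), 1 ≤ M → (∀ i, |x i| ≤ M) →
      |eval x P| ≤ C * (M : ℤ) ^ D := by
  induction P using MvPolynomial.induction_on with
  | C a =>
    refine ⟨a.natAbs, 0, fun M x _ _ => ?_⟩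
    simp
  | add p q hp hq =>
    obtain ⟨C1, D1, h1⟩ := hp
    obtain ⟨C2, D2, h2⟩ := hq
    refine ⟨C1 + C2, D1 + D2, fun M x hM hx => ?_⟩
    have hM' : (1 : ℤ) ≤ M := by exact_mod_cast hM
    have l1 : (M : ℤ) ^ D1 ≤ (M : ℤ) ^ (D1 + D2) := pow_le_pow_right₀ hM' (by omega)
    have l2 : (M : ℤ) ^ D2 ≤ (M : ℤ) ^ (D1 + D2) := pow_le_pow_right₀ hM' (by omega)
    rw [map_add]
    push_cast
    calc |eval x p + eval x q| ≤ C1 * (M : ℤ) ^ D1 + C2 * (M : ℤ) ^ D2 :=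
          (abs_add_le _ _).trans (add_le_add (h1 M x hM hx) (h2 M x hM hx))
      _ ≤ C1 * (M : ℤ) ^ (D1 + D2) + C2 * (M : ℤ) ^ (D1 + D2) := by gcongr
      _ = _ := by ring
  | mul_X p i hp =>
    obtain ⟨C1, D1, h1⟩ := hp
    refine ⟨C1, D1 + 1, fun M x hM hx => ?_⟩
    rw [map_mul, eval_X, abs_mul, pow_succ, ← mul_assoc]
    exact mul_le_mul (h1 M x hM hx) (hx i) (abs_nonneg _) (by positivity)

lemma sum_truncRecipSum_le_of_antitone (m : ℕ) (P : MvPolynomial (Fin m) ℤ) (hP : P ≠ 0)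
    (ε : ℝ) (hε : 0 < ε) :
    ∃ B : ℕ, ∀ z ≥ B, ∀ s : Fin m → ℕ, Antitone s → (∀ i, B ≤ s i) →
      ∑ c ∈ intBox s, truncRecipSum z (eval c P) ≤ ε * (intBox s).card := by
  induction m generalizing ε with
  | zero =>
    obtain ⟨a, rfl⟩ := MvPolynomial.C_surjective (Fin 0) P
    refine ⟨a.natAbs, fun z hz s _ _ => ?_⟩
    have ha : a ≠ 0 := fun h => hP (by simp [h])
    have h0 : primeRecipSum z a = 0 := by
      unfold primeRecipSum
      rw [Finset.filter_eq_empty_iff.2, Finset.sum_empty]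
      intro p hp
      have := Nat.le_of_dvd (by omega) (Nat.dvd_of_mem_primeFactors hp)
      omega
    have : ∀ c ∈ intBox s, truncRecipSum z (eval c (C a)) ≤ 0 := by
      intro c _
      rw [eval_C, truncRecipSum, if_neg ha, h0]
      exact min_le_right _ _
    exact (Finset.sum_nonpos this).trans (by positivity)
  | succ m ih =>
    set Q := finSuccEquiv ℤ m P with hQ
    have hQ0 : Q ≠ 0 := by simpa [hQ] using hP
    set k := Q.natDegree
    obtain ⟨B, hB⟩ := ih (Q.coeff k) (by simpa [k] using hQ0) (ε / 2) (by positivity)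
    obtain ⟨K, D, hKD⟩ := exists_abs_eval_le P
    obtain ⟨B', hB'⟩ := exists_nat_gt ((k + 2 * k + (D + 1)) / (ε / 2) : ℝ)
    refine ⟨max (max B B') (max K 1), fun z hz s hs hsB => ?_⟩
    simp only [ge_iff_le, max_le_iff] at hz hsB
    set M := s 0 with hM
    have hsplit : s = Fin.insertNth 0 M (Fin.tail s) := by
      rw [Fin.insertNth_zero', hM, Fin.cons_self_tail]
    have hM0 := hsB 0
    rw [← hM] at hM0
    have hM' : (0 : ℝ) < M := by exact_mod_cast hM0.2.2
    have hz' : (0 : ℝ) < z := by exact_mod_cast hz.2.2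
    have hsmall : (k / M + 2 * k / z + (D + 1) / M : ℝ) ≤ ε / 2 := by
      have hB'0 : (0 : ℝ) < B' := lt_of_le_of_lt (by positivity) hB'
      have h1 : (B' : ℝ) ≤ M := by exact_mod_cast hM0.1.2
      have h2 : (B' : ℝ) ≤ z := by exact_mod_cast hz.1.2
      calc (k / M + 2 * k / z + (D + 1) / M : ℝ) ≤ k / B' + 2 * k / B' + (D + 1) / B' := by
            gcongr
        _ = (k + 2 * k + (D + 1)) / B' := by ring
        _ ≤ ε / 2 := by
            rw [div_le_iff₀ hB'0]
            rw [div_lt_iff₀ (by positivity)] at hB'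
            linarith
    have htail : Antitone (Fin.tail s) := fun i j hij => hs (Fin.succ_le_succ_iff.2 hij)
    have hrec := hB z hz.1.1 (Fin.tail s) htail fun i => (hsB i.succ).1.1
    have hstep : ∀ c ∈ intBox (Fin.tail s), ∑ t ∈ Finset.Icc (-(M : ℤ)) M,
        truncRecipSum z (eval (Fin.insertNth 0 t c : Fin (m + 1) → ℤ) P) ≤
        (truncRecipSum z (eval c (Q.coeff k)) + ε / 2) * (2 * M + 1) := by
      intro c hc
      rw [mem_intBox] at hc
      have hev : ∀ t : ℤ, eval (Fin.insertNth 0 t c : Fin (m + 1) → ℤ) P =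
          (Q.map (eval c)).eval t := by
        intro t
        rw [Fin.insertNth_zero', eval_eq_eval_mv_eval']
      simp only [hev]
      have := sum_truncRecipSum_eval_le z M k K D (Q.map (eval c)) hz.2.2 hM0.2.2 hM0.2.1
        Polynomial.natDegree_map_le (by
          intro t ht
          rw [← hev]
          refine hKD M _ hM0.2.2 fun i => ?_
          rw [Fin.insertNth_zero']
          refine Fin.cases ?_ (fun j => ?_) i
          · simpa [abs_le] using ht
          · rw [Fin.cons_succ]
            refine (hc j).trans ?_
            exact_mod_cast hs (Fin.zero_le j.succ))
      rw [Polynomial.coeff_map] at this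
      refine this.trans ?_
      gcongr
    rw [hsplit, sum_intBox_insertNth, card_intBox_insertNth]
    calc _ ≤ ∑ c ∈ intBox (Fin.tail s),
          (truncRecipSum z (eval c (Q.coeff k)) + ε / 2) * (2 * M + 1) := Finset.sum_le_sum hstep
      _ = (∑ c ∈ intBox (Fin.tail s), truncRecipSum z (eval c (Q.coeff k)) +
            ε / 2 * (intBox (Fin.tail s)).card) * (2 * M + 1) := by
          rw [← Finset.sum_mul, Finset.sum_add_distrib, Finset.sum_const, nsmul_eq_mul]
          ring
      _ ≤ (ε / 2 * (intBox (Fin.tail s)).card + ε / 2 * (intBox (Fin.tail s)).card) *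
            (2 * M + 1) := by gcongr
      _ = _ := by ring

/-- The average of `truncRecipSum` over the values of a nonzero polynomial is small, uniformly
over all boxes with long sides. -/
lemma sum_truncRecipSum_le (m : ℕ) (P : MvPolynomial (Fin m) ℤ) (hP : P ≠ 0)
    (ε : ℝ) (hε : 0 < ε) :
    ∃ B : ℕ, ∀ z ≥ B, ∀ s : Fin m → ℕ, (∀ i, B ≤ s i) →
      ∑ c ∈ intBox s, truncRecipSum z (eval c P) ≤ ε * (intBox s).card := by
  have h : ∀ σ : Equiv.Perm (Fin m), ∃ B : ℕ, ∀ z ≥ B, ∀ s : Fin m → ℕ, Antitone s →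
      (∀ i, B ≤ s i) → ∑ c ∈ intBox s, truncRecipSum z (eval c (rename σ P)) ≤
        ε * (intBox s).card := fun σ =>
    sum_truncRecipSum_le_of_antitone m (rename σ P)
      (fun h => hP (rename_injective σ σ.injective (by simpa using h))) ε hε
  choose B hB using h
  refine ⟨Finset.univ.sup B, fun z hz s hs => ?_⟩
  set τ : Equiv.Perm (Fin m) := Tuple.sort (OrderDual.toDual ∘ s)
  have hτ : Antitone (s ∘ τ) := by
    have := Tuple.monotone_sort (OrderDual.toDual ∘ s)
    exact fun i j hij => this hij
  have hle : B τ.symm ≤ Finset.univ.sup B := Finset.le_sup (Finset.mem_univ _)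
  have := hB τ.symm z (hle.trans hz) (s ∘ τ) hτ fun i => hle.trans (hs _)
  have hcard : (intBox (s ∘ τ)).card = (intBox s).card := by
    rw [card_intBox, card_intBox]
    exact Equiv.prod_comp τ fun i => 2 * s i + 1
  rw [hcard] at this
  refine le_trans (le_of_eq ?_) this
  refine Finset.sum_bij' (fun c _ => c ∘ τ) (fun c _ => c ∘ τ.symm) ?_ ?_ ?_ ?_ ?_
  · intro c hc
    rw [mem_intBox] at hc ⊢
    exact fun i => hc (τ i)
  · intro c hc
    rw [mem_intBox] at hc ⊢
    intro i
    simpa using hc (τ.symm i)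
  · intro c _; ext i; simp
  · intro c _; ext i; simp
  · intro c _
    have e : (c ∘ τ) ∘ τ.symm = c := by ext i; simp
    rw [eval_rename, e]

/-! ### The contribution of large primes -/

lemma dvd_eval_sub_eval {σ : Type*} (n : ℤ) (Q : MvPolynomial σ ℤ) (c c' : σ → ℤ)
    (h : ∀ i, n ∣ c i - c' i) : n ∣ eval c Q - eval c' Q := by
  induction Q using MvPolynomial.induction_on with
  | C a => simp
  | add p q hp hq =>
    rw [map_add, map_add, add_sub_add_comm]
    exact dvd_add hp hq
  | mul_X p i hp =>
    have e : eval c p * c i - eval c' p * c' i =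
        (eval c p - eval c' p) * c i + eval c' p * (c i - c' i) := by ring
    rw [map_mul, map_mul, eval_X, eval_X, e]
    exact dvd_add (hp.mul_right _) ((h i).mul_left _)

open Classical in
lemma card_dvd_dvd_le (z M : ℕ) (a : ℤ) :
    (((Finset.Icc (-(M : ℤ)) M).filter fun t => ∃ p : ℕ, p.Prime ∧ z < p ∧
      (p : ℤ) ∣ t ∧ (p : ℤ) ∣ a).card : ℝ) ≤ truncRecipSum z a * (2 * M + 1) + 1 := by
  have htriv : (((Finset.Icc (-(M : ℤ)) M).filter fun t => ∃ p : ℕ, p.Prime ∧ z < p ∧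
      (p : ℤ) ∣ t ∧ (p : ℤ) ∣ a).card : ℝ) ≤ 2 * M + 1 := by
    have := Finset.card_filter_le (Finset.Icc (-(M : ℤ)) M) fun t => ∃ p : ℕ, p.Prime ∧ z < p ∧
      (p : ℤ) ∣ t ∧ (p : ℤ) ∣ a
    rw [card_Icc_neg] at this
    exact_mod_cast this
  by_cases h1 : truncRecipSum z a = 1
  · rw [h1]; linarith
  have ha : a ≠ 0 := fun h => h1 (by simp [truncRecipSum, h])
  have hS : truncRecipSum z a = primeRecipSum z a := by
    rw [truncRecipSum, if_neg ha] at h1 ⊢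
    exact min_eq_right (le_of_not_ge fun h => h1 (min_eq_left h))
  have hsub : ((Finset.Icc (-(M : ℤ)) M).filter fun t => ∃ p : ℕ, p.Prime ∧ z < p ∧
      (p : ℤ) ∣ t ∧ (p : ℤ) ∣ a) ⊆ {0} ∪ (a.natAbs.primeFactors.filter (z < ·)).biUnion
      fun p => ((Finset.Icc (-(M : ℤ)) M).filter fun t => t ≡ 0 [ZMOD p]).erase 0 := by
    intro t ht
    obtain ⟨ht1, p, hp, hzp, hpt, hpa⟩ := Finset.mem_filter.1 ht
    by_cases h0 : t = 0
    · simp [h0]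
    refine Finset.mem_union_right _ (Finset.mem_biUnion.2 ⟨p, ?_, ?_⟩)
    · exact Finset.mem_filter.2
        ⟨Nat.mem_primeFactors.2 ⟨hp, Int.natCast_dvd.1 hpa, by simpa using ha⟩, hzp⟩
    · exact Finset.mem_erase.2 ⟨h0, Finset.mem_filter.2 ⟨ht1, Int.modEq_zero_iff_dvd.2 hpt⟩⟩
  have hcard := (Finset.card_le_card hsub).trans (Finset.card_union_le _ _)
  rw [Finset.card_singleton] at hcard
  have hcard2 := hcard.trans (Nat.add_le_add_left Finset.card_biUnion_le 1)
  rw [hS]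
  calc _ ≤ ((1 + ∑ p ∈ a.natAbs.primeFactors.filter (z < ·),
        (((Finset.Icc (-(M : ℤ)) M).filter fun t => t ≡ 0 [ZMOD p]).erase 0).card : ℕ) : ℝ) := by
        exact_mod_cast hcard2
    _ ≤ 1 + ∑ p ∈ a.natAbs.primeFactors.filter (z < ·), (p : ℝ)⁻¹ * (2 * M + 1) := by
        push_cast
        gcongr with p hp
        have hpp := Nat.prime_of_mem_primeFactors (Finset.mem_filter.1 hp).1
        rw [Finset.cast_card_erase_of_mem (by simp)]
        have := card_modEq_le M p hpp.pos 0
        rw [inv_mul_eq_div]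
        linarith
    _ = _ := by rw [← Finset.sum_mul, primeRecipSum]; ring

open Classical in
/-- Two conditions modulo a common large prime rarely hold simultaneously. -/
lemma card_dvd_coord_dvd_eval_le (m : ℕ) (v : Fin (m + 1)) (Q : MvPolynomial (Fin (m + 1)) ℤ)
    (hQ : ∃ c : Fin (m + 1) → ℤ, c v = 0 ∧ eval c Q ≠ 0) (ε : ℝ) (hε : 0 < ε) :
    ∃ B : ℕ, ∀ z ≥ B, ∀ s : Fin (m + 1) → ℕ, (∀ i, B ≤ s i) →
      (((intBox s).filter fun c => ∃ p : ℕ, p.Prime ∧ z < p ∧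
        (p : ℤ) ∣ c v ∧ (p : ℤ) ∣ eval c Q).card : ℝ) ≤ ε * (intBox s).card := by
  set Ψ : MvPolynomial (Fin m) ℤ :=
    aeval (Fin.insertNth v 0 X : Fin (m + 1) → MvPolynomial (Fin m) ℤ) Q with hΨ
  have hev : ∀ c : Fin m → ℤ, eval c Ψ = eval (Fin.insertNth v 0 c : Fin (m + 1) → ℤ) Q := by
    intro c
    have h1 : eval c Ψ = eval₂ (RingHom.id ℤ) (fun i => eval c
        ((Fin.insertNth v 0 X : Fin (m + 1) → MvPolynomial (Fin m) ℤ) i)) Q := by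
      rw [hΨ, aeval_def, eval₂_comp_left (eval c)]
      congr 1
      ext; simp
    rw [h1, ← eval₂_id]
    congr 1
    ext i
    refine Fin.succAboveCases v ?_ (fun j => ?_) i <;> simp
  have hΨ0 : Ψ ≠ 0 := by
    obtain ⟨c, hc, hcQ⟩ := hQ
    intro h
    apply hcQ
    have := hev (v.removeNth c)
    rw [h, map_zero] at this
    have e : (Fin.insertNth v 0 (v.removeNth c) : Fin (m + 1) → ℤ) = c := by
      rw [← hc, Fin.insertNth_self_removeNth]
    rw [e] at this
    exact this.symm
  obtain ⟨B, hB⟩ := sum_truncRecipSum_le m Ψ hΨ0 (ε / 2) (by positivity)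
  obtain ⟨B', hB'⟩ := exists_nat_gt (2 / ε)
  refine ⟨max B B', fun z hz s hs => ?_⟩
  obtain ⟨M, s', rfl⟩ : ∃ M s', s = (Fin.insertNth v M s' : Fin (m + 1) → ℕ) :=
    ⟨s v, v.removeNth s, by simp⟩
  have hM := hs v
  rw [Fin.insertNth_apply_same] at hM
  have hs' : ∀ i, B ≤ s' i := fun i => by
    have := hs (v.succAbove i)
    rw [Fin.insertNth_apply_succAbove] at this
    exact (le_max_left _ _).trans this
  have hM' : (B' : ℝ) ≤ M := by exact_mod_cast (le_max_right _ _).trans hM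
  have h1 : 1 ≤ ε / 2 * (2 * M + 1) := by
    have : 2 / ε < M := hB'.trans_le hM'
    rw [div_lt_iff₀ hε] at this
    nlinarith
  rw [Finset.card_filter, Nat.cast_sum, sum_intBox_insertNth, card_intBox_insertNth]
  calc _ ≤ ∑ c ∈ intBox s', (truncRecipSum z (eval c Ψ) * (2 * M + 1) + 1) := by
        refine Finset.sum_le_sum fun c _ => ?_
        refine le_trans ?_ (card_dvd_dvd_le z M (eval c Ψ))
        rw [← Nat.cast_sum, ← Finset.card_filter]
        refine Nat.cast_le.2 (Finset.card_le_card (Finset.monotone_filter_right _ ?_))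
        rintro t - ⟨p, hp, hzp, hpt, hpa⟩
        rw [Fin.insertNth_apply_same] at hpt
        refine ⟨p, hp, hzp, hpt, ?_⟩
        have hd := dvd_eval_sub_eval (p : ℤ) Q (Fin.insertNth v t c : Fin (m + 1) → ℤ)
          (Fin.insertNth v 0 c : Fin (m + 1) → ℤ) fun i => by
            refine Fin.succAboveCases v ?_ (fun j => ?_) i <;> simp [hpt]
        rw [hev]
        exact (dvd_sub_right hpa).1 hd
    _ ≤ ∑ c ∈ intBox s', (truncRecipSum z (eval c Ψ) * (2 * M + 1) + ε / 2 * (2 * M + 1)) := by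
        gcongr
    _ = (∑ c ∈ intBox s', truncRecipSum z (eval c Ψ)) * (2 * M + 1) +
          ε / 2 * ((intBox s').card * (2 * M + 1)) := by
        rw [Finset.sum_add_distrib, ← Finset.sum_mul, Finset.sum_const, nsmul_eq_mul]; ring
    _ ≤ ε / 2 * (intBox s').card * (2 * M + 1) + ε / 2 * ((intBox s').card * (2 * M + 1)) := by
        gcongr
        exact hB z ((le_max_left _ _).trans hz) s' hs'
    _ = _ := by ring

lemma eventually_primeCounting_mul_le (K : ℕ) (η : ℝ) (hη : 0 < η) :
    ∀ᶠ T : ℕ in atTop, ((Nat.primeCounting (K * T) : ℕ) : ℝ) ≤ η * T := by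
  rcases Nat.eq_zero_or_pos K with rfl | hK
  · refine Eventually.of_forall fun T => ?_
    simp; positivity
  have hK' : (0 : ℝ) < K := by exact_mod_cast hK
  have htend : Tendsto (fun T : ℕ => (K : ℝ) * T) atTop atTop :=
    tendsto_natCast_atTop_atTop.const_mul_atTop hK'
  have h1 := htend.eventually (Chebyshev.eventually_primeCounting_le (ε := 1) one_pos)
  have h2 := htend.eventually (Real.tendsto_log_atTop.eventually_ge_atTop
    ((Real.log 4 + 1) * K / η + 1))
  have hl4 : 0 ≤ Real.log 4 := Real.log_nonneg (by norm_num)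
  filter_upwards [h1, h2] with T h1 h2
  have hfl : ⌊(K : ℝ) * T⌋₊ = K * T := by
    rw [← Nat.cast_mul, Nat.floor_natCast]
  rw [hfl] at h1
  have hpos : 0 ≤ (Real.log 4 + 1) * K / η := by positivity
  refine h1.trans ?_
  rw [div_le_iff₀ (by linarith)]
  have h3 : (Real.log 4 + 1) * K ≤ η * Real.log (K * T) := by
    have : (Real.log 4 + 1) * K / η ≤ Real.log (K * T) := by linarith
    rwa [div_le_iff₀ hη, mul_comm _ η] at this
  calc (Real.log 4 + 1) * (K * T) = (Real.log 4 + 1) * K * T := by ring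
    _ ≤ η * Real.log (K * T) * T := by gcongr
    _ = _ := by ring

lemma Polynomial.exists_abs_eval_le (g : Polynomial ℤ) (d : ℕ) (hd : g.natDegree ≤ d) :
    ∃ K : ℕ, ∀ (T : ℕ) (t : ℤ), 1 ≤ T → |t| ≤ T → |g.eval t| ≤ K * (T : ℤ) ^ d := by
  refine ⟨∑ i ∈ Finset.range (d + 1), (g.coeff i).natAbs, fun T t hT ht => ?_⟩
  rw [Polynomial.eval_eq_sum_range' (Nat.lt_succ_of_le hd)]
  refine (Finset.abs_sum_le_sum_abs _ _).trans ?_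
  push_cast
  rw [Finset.sum_mul]
  refine Finset.sum_le_sum fun i hi => ?_
  rw [abs_mul, abs_pow]
  gcongr
  have hT' : (1 : ℤ) ≤ T := by exact_mod_cast hT
  calc |t| ^ i ≤ (T : ℤ) ^ i := by gcongr
    _ ≤ _ := pow_le_pow_right₀ hT' (by simpa [Nat.lt_succ_iff] using hi)

open Classical in
/-- Values of a separable polynomial of degree at most `d` divisible by `p ^ d` for some large
prime `p`. -/
lemma eventually_card_pow_dvd_eval_le (d z : ℕ) (hd : 2 ≤ d) (hz : 1 ≤ z) (g U V : Polynomial ℤ)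
    (a : ℤ) (hdeg : g.natDegree ≤ d) (ha : a ≠ 0)
    (hUV : U * g + V * g.derivative = Polynomial.C a)
    (hg : ∀ p : ℕ, p.Prime → z < p → ∃ k, ¬ (p : ℤ) ∣ g.coeff k) (η : ℝ) (hη : 0 < η) :
    ∀ᶠ T : ℕ in atTop, (((Finset.Icc (-(T : ℤ)) T).filter fun t => ∃ p : ℕ, p.Prime ∧ z < p ∧
      (p : ℤ) ^ d ∣ g.eval t).card : ℝ) ≤ (2 * T + 1) * (d * primeRecipSum z a + d / z + η) := by
  classical
  obtain ⟨K, hK⟩ := g.exists_abs_eval_le d hdeg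
  have hg0 : g ≠ 0 := by
    rintro rfl
    rw [Polynomial.derivative_zero, mul_zero, mul_zero, add_zero] at hUV
    exact ha (Polynomial.C_eq_zero.1 hUV.symm)
  have hd' : (0 : ℝ) < d := by exact_mod_cast (by omega : 0 < d)
  have hz' : (0 : ℝ) < z := by exact_mod_cast hz
  set w : ℝ := d * (1 + a.natAbs.primeFactors.card) with hw
  have hT2 : ∀ᶠ T : ℕ in atTop, w ≤ η * T := by
    have : Tendsto (fun T : ℕ => η * (T : ℝ)) atTop atTop :=
      tendsto_natCast_atTop_atTop.const_mul_atTop hη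
    exact this.eventually_ge_atTop w
  filter_upwards [eventually_ge_atTop 1, hT2,
    eventually_primeCounting_mul_le K (η / d) (by positivity)] with T hT1 hT2 hT3
  set I := Finset.Icc (-(T : ℤ)) T
  set A := (Finset.Ioc z (K * T)).filter fun p : ℕ => p.Prime ∧ ¬ (p : ℤ) ∣ a
  set B := a.natAbs.primeFactors.filter (z < ·)
  have hsub : (I.filter fun t => ∃ p : ℕ, p.Prime ∧ z < p ∧ (p : ℤ) ^ d ∣ g.eval t) ⊆
      (I.filter fun t => g.eval t = 0) ∪
      ((A.biUnion fun p => I.filter fun t => (p : ℤ) ^ d ∣ g.eval t) ∪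
        (B.biUnion fun p => I.filter fun t => (p : ℤ) ∣ g.eval t)) := by
    intro t ht
    obtain ⟨htI, p, hp, hzp, hpd⟩ := Finset.mem_filter.1 ht
    by_cases h0 : g.eval t = 0
    · exact Finset.mem_union_left _ (Finset.mem_filter.2 ⟨htI, h0⟩)
    refine Finset.mem_union_right _ ?_
    by_cases hpa : (p : ℤ) ∣ a
    · refine Finset.mem_union_right _ (Finset.mem_biUnion.2 ⟨p, ?_, Finset.mem_filter.2 ⟨htI, ?_⟩⟩)
      · exact Finset.mem_filter.2
          ⟨Nat.mem_primeFactors.2 ⟨hp, Int.natCast_dvd.1 hpa, by simpa using ha⟩, hzp⟩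
      · exact (dvd_pow_self (p : ℤ) (by omega)).trans hpd
    · refine Finset.mem_union_left _ (Finset.mem_biUnion.2 ⟨p, ?_, Finset.mem_filter.2 ⟨htI, hpd⟩⟩)
      refine Finset.mem_filter.2 ⟨Finset.mem_Ioc.2 ⟨hzp, ?_⟩, hp, hpa⟩
      have h1 : (p : ℤ) ^ d ≤ K * (T : ℤ) ^ d :=
        (Int.le_of_dvd (abs_pos.2 h0) ((dvd_abs _ _).2 hpd)).trans
          (hK T t hT1 (abs_le.2 (Finset.mem_Icc.1 htI)))
      have h2 : p ^ d ≤ (K * T) ^ d := by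
        rw [mul_pow]
        calc p ^ d ≤ K * T ^ d := by exact_mod_cast h1
          _ ≤ K ^ d * T ^ d := Nat.mul_le_mul_right _ (Nat.le_self_pow (by omega) K)
      exact (Nat.pow_le_pow_iff_left (by omega)).1 h2
  have hcard : ((I.filter fun t => ∃ p : ℕ, p.Prime ∧ z < p ∧ (p : ℤ) ^ d ∣ g.eval t).card : ℝ) ≤
      (I.filter fun t => g.eval t = 0).card +
      (∑ p ∈ A, ((I.filter fun t => (p : ℤ) ^ d ∣ g.eval t).card : ℝ) +
        ∑ p ∈ B, ((I.filter fun t => (p : ℤ) ∣ g.eval t).card : ℝ)) := by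
    refine le_trans (Nat.cast_le.2 (Finset.card_le_card hsub)) ?_
    refine le_trans (Nat.cast_le.2 (Finset.card_union_le _ _)) ?_
    push_cast
    gcongr
    refine le_trans (Nat.cast_le.2 (Finset.card_union_le _ _)) ?_
    push_cast
    rw [← Nat.cast_sum, ← Nat.cast_sum]
    gcongr <;> exact Finset.card_biUnion_le
  have e1 := card_eval_eq_zero_le T d g hdeg hg0
  have hAcard : (A.card : ℝ) ≤ η / d * T := by
    refine le_trans (Nat.cast_le.2 ?_) hT3
    rw [Nat.primeCounting, Nat.primeCounting', Nat.count_eq_card_filter_range]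
    refine Finset.card_le_card fun p hp => ?_
    simp only [A, Finset.mem_filter, Finset.mem_Ioc, Finset.mem_range] at hp ⊢
    exact ⟨by omega, hp.2.1⟩
  have e2 : ∑ p ∈ A, ((I.filter fun t => (p : ℤ) ^ d ∣ g.eval t).card : ℝ) ≤
      d / z * (2 * T + 1) + η * T := by
    calc _ ≤ ∑ p ∈ A, (d * (2 * T + 1) * ((p : ℝ) ^ 2)⁻¹ + d : ℝ) := by
          refine Finset.sum_le_sum fun p hp => ?_
          simp only [A, Finset.mem_filter, Finset.mem_Ioc] at hp
          have hp0 : (1 : ℝ) ≤ p := by exact_mod_cast hp.2.1.one_le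
          refine (card_pow_dvd_eval_le T p d d (by omega) hp.2.1 g U V a hdeg hUV hp.2.2).trans ?_
          calc (d * ((2 * T + 1) / (p : ℝ) ^ d + 1) : ℝ) ≤ d * ((2 * T + 1) / (p : ℝ) ^ 2 + 1) := by
                gcongr
            _ = _ := by field_simp
      _ = d * (2 * T + 1) * ∑ p ∈ A, ((p : ℝ) ^ 2)⁻¹ + d * A.card := by
          rw [Finset.sum_add_distrib, Finset.mul_sum, Finset.sum_const, nsmul_eq_mul, mul_comm (d : ℝ) (A.card : ℝ)]
      _ ≤ d * (2 * T + 1) * (z : ℝ)⁻¹ + d * (η / d * T) := by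
          gcongr
          refine le_trans ?_ (sum_inv_sq_le z (K * T) (by omega))
          exact Finset.sum_le_sum_of_subset_of_nonneg (Finset.filter_subset _ _)
            fun _ _ _ => by positivity
      _ = _ := by field_simp
  have e3 : ∑ p ∈ B, ((I.filter fun t => (p : ℤ) ∣ g.eval t).card : ℝ) ≤
      d * (2 * T + 1) * primeRecipSum z a + d * a.natAbs.primeFactors.card := by
    calc _ ≤ ∑ p ∈ B, (d * (2 * T + 1) * (p : ℝ)⁻¹ + d : ℝ) := by
          refine Finset.sum_le_sum fun p hp => ?_
          obtain ⟨hp1, hp2⟩ := Finset.mem_filter.1 hp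
          have hpp := Nat.prime_of_mem_primeFactors hp1
          obtain ⟨k, hk⟩ := hg p hpp hp2
          refine (card_dvd_eval_le T p d hpp g hdeg
            (map_castRingHom_ne_zero_of_not_dvd p g k hk)).trans (le_of_eq ?_)
          field_simp
      _ = d * (2 * T + 1) * primeRecipSum z a + d * B.card := by
          rw [Finset.sum_add_distrib, primeRecipSum, Finset.mul_sum, Finset.sum_const,
            nsmul_eq_mul, mul_comm (d : ℝ) (B.card : ℝ)]
      _ ≤ _ := by
          gcongr
          exact Finset.filter_subset _ _
  have : (2 * T + 1) * (d * primeRecipSum z a + d / z + η) =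
      d * (2 * T + 1) * primeRecipSum z a + d / z * (2 * T + 1) + 2 * (η * T) + η := by ring
  rw [this]
  have : w = d + d * a.natAbs.primeFactors.card := by rw [hw]; ring
  linarith

open Classical in
lemma eventually_card_pow_dvd_eval_le_of_specialization (m d z : ℕ) (hd : 2 ≤ d) (hz : 1 ≤ z)
    (P U V : Polynomial (MvPolynomial (Fin (m + 1)) ℤ)) (Δ : MvPolynomial (Fin (m + 1)) ℤ)
    (hdeg : P.natDegree ≤ d) (hUV : U * P + V * P.derivative = Polynomial.C Δ)
    (η : ℝ) (hη : 0 < η) (c : Fin (m + 1) → ℤ) :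
    ∀ᶠ T : ℕ in atTop, (((Finset.Icc (-(T : ℤ)) T).filter fun t => ∃ p : ℕ, p.Prime ∧ z < p ∧
      (p : ℤ) ^ d ∣ (P.map (eval c)).eval t).card : ℝ) ≤
      (2 * T + 1) * (d * truncRecipSum z (eval c Δ) +
        (if ∃ p : ℕ, p.Prime ∧ z < p ∧ ∀ k, (p : ℤ) ∣ eval c (P.coeff k) then 1 else 0) +
          (d / z + η)) := by
  have htriv : ∀ T : ℕ, (((Finset.Icc (-(T : ℤ)) T).filter fun t => ∃ p : ℕ, p.Prime ∧ z < p ∧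
      (p : ℤ) ^ d ∣ (P.map (eval c)).eval t).card : ℝ) ≤ (2 * T + 1) * 1 := fun T => by
    have := Finset.card_filter_le (Finset.Icc (-(T : ℤ)) T) fun t => ∃ p : ℕ, p.Prime ∧ z < p ∧
      (p : ℤ) ^ d ∣ (P.map (eval c)).eval t
    rw [card_Icc_neg] at this
    rw [mul_one]
    exact_mod_cast this
  have hd' : (2 : ℝ) ≤ d := by exact_mod_cast hd
  have hS0 := truncRecipSum_nonneg z (eval c Δ)
  have hdz : (0 : ℝ) ≤ d / z := by positivity
  by_cases hE : ∃ p : ℕ, p.Prime ∧ z < p ∧ ∀ k, (p : ℤ) ∣ eval c (P.coeff k)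
  · refine Eventually.of_forall fun T => (htriv T).trans ?_
    rw [if_pos hE]
    gcongr
    nlinarith
  rw [if_neg hE]
  by_cases h1 : truncRecipSum z (eval c Δ) = 1
  · refine Eventually.of_forall fun T => (htriv T).trans ?_
    rw [h1]
    gcongr
    linarith
  have ha : eval c Δ ≠ 0 := fun h => h1 (by simp [truncRecipSum, h])
  have hS : truncRecipSum z (eval c Δ) = primeRecipSum z (eval c Δ) := by
    rw [truncRecipSum, if_neg ha] at h1 ⊢
    exact min_eq_right (le_of_not_ge fun h => h1 (min_eq_left h))
  rw [hS, add_zero]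
  have hmap := congrArg (Polynomial.map (eval c)) hUV
  rw [Polynomial.map_add, Polynomial.map_mul, Polynomial.map_mul, ← Polynomial.derivative_map,
    Polynomial.map_C] at hmap
  push Not at hE
  have := eventually_card_pow_dvd_eval_le d z hd hz (P.map (eval c)) (U.map (eval c))
    (V.map (eval c)) (eval c Δ) (Polynomial.natDegree_map_le.trans hdeg) ha hmap
    (fun p hp hzp => by simpa only [Polynomial.coeff_map] using hE p hp hzp) η hη
  filter_upwards [this] with T hT
  rw [← add_assoc]
  exact hT

open Classical in
/-- Tuples at which the value of a polynomial, separable of degree at most `d` in one of the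
variables, is divisible by `p ^ d` for some large prime `p`. -/
theorem eventually_card_large_prime_le (m d : ℕ) (hd : 2 ≤ d) (n : Fin (m + 2))
    (P U V : Polynomial (MvPolynomial (Fin (m + 1)) ℤ)) (Δ : MvPolynomial (Fin (m + 1)) ℤ)
    (R : (Fin (m + 2) → ℤ) → ℤ)
    (hR : ∀ t c, (P.map (eval c)).eval t = R (Fin.insertNth n t c : Fin (m + 2) → ℤ))
    (hdeg : P.natDegree ≤ d) (hΔ : Δ ≠ 0) (hUV : U * P + V * P.derivative = Polynomial.C Δ)
    (hc : ∀ (c : Fin (m + 1) → ℤ) (p : ℕ), p.Prime → (∀ k, (p : ℤ) ∣ eval c (P.coeff k)) →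
      ∃ v, (p : ℤ) ∣ c v)
    (hv : ∀ v, ∃ (k : ℕ) (c : Fin (m + 1) → ℤ), c v = 0 ∧ eval c (P.coeff k) ≠ 0)
    (ε : ℝ) (hε : 0 < ε) :
    ∃ z₀ : ℕ, ∀ z ≥ z₀, ∀ᶠ s : Fin (m + 1) → ℕ in atTop, ∀ᶠ T : ℕ in atTop,
      (((intBox (Fin.insertNth n T s : Fin (m + 2) → ℕ)).filter fun x =>
        ∃ p : ℕ, p.Prime ∧ z < p ∧ (p : ℤ) ^ d ∣ R x).card : ℝ) ≤
      ε * (intBox (Fin.insertNth n T s : Fin (m + 2) → ℕ)).card := by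
  have hd' : (0 : ℝ) < d := by exact_mod_cast (by omega : 0 < d)
  obtain ⟨B₁, hB₁⟩ := sum_truncRecipSum_le (m + 1) Δ hΔ (ε / (4 * d)) (by positivity)
  choose k hk using hv
  have h := fun v => card_dvd_coord_dvd_eval_le m v (P.coeff (k v)) (hk v)
    (ε / (4 * (m + 1))) (by positivity)
  choose B₂ hB₂ using h
  obtain ⟨B₃, hB₃⟩ := exists_nat_gt (d / (ε / 4) : ℝ)
  set z₀ := max (max B₁ (Finset.univ.sup B₂)) (max B₃ 1) with hz₀
  have hB₂z : ∀ v, B₂ v ≤ z₀ := fun v => (Finset.le_sup (Finset.mem_univ v)).trans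
    ((le_max_right _ _).trans (le_max_left _ _))
  refine ⟨z₀, fun z hz => ?_⟩
  filter_upwards [eventually_ge_atTop (fun _ => z₀)] with s hs
  have hz1 : 1 ≤ z := by omega
  have hev := (eventually_all_finset (intBox s)).2 fun c _ =>
    eventually_card_pow_dvd_eval_le_of_specialization m d z hd hz1 P U V Δ hdeg hUV
      (ε / 4) (by positivity) c
  filter_upwards [hev] with T hT
  have hA := hB₁ z (by omega) s fun i => by have : z₀ ≤ s i := hs i; omega
  have hE : ∑ c ∈ intBox s, (if ∃ p : ℕ, p.Prime ∧ z < p ∧ ∀ k, (p : ℤ) ∣ eval c (P.coeff k)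
      then (1 : ℝ) else 0) ≤ ε / 4 * (intBox s).card := by
    rw [Finset.sum_boole]
    have hsub : ((intBox s).filter fun c => ∃ p : ℕ, p.Prime ∧ z < p ∧
        ∀ k, (p : ℤ) ∣ eval c (P.coeff k)) ⊆ Finset.univ.biUnion fun v =>
        (intBox s).filter fun c => ∃ p : ℕ, p.Prime ∧ z < p ∧
          (p : ℤ) ∣ c v ∧ (p : ℤ) ∣ eval c (P.coeff (k v)) := by
      intro c hcm
      obtain ⟨hcs, p, hp, hzp, hall⟩ := Finset.mem_filter.1 hcm
      obtain ⟨v, hpv⟩ := hc c p hp hall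
      exact Finset.mem_biUnion.2 ⟨v, Finset.mem_univ _,
        Finset.mem_filter.2 ⟨hcs, p, hp, hzp, hpv, hall _⟩⟩
    refine le_trans (Nat.cast_le.2 ((Finset.card_le_card hsub).trans Finset.card_biUnion_le)) ?_
    push_cast
    calc _ ≤ ∑ _v : Fin (m + 1), ε / (4 * (m + 1)) * ((intBox s).card : ℝ) :=
          Finset.sum_le_sum fun v _ => hB₂ v z ((hB₂z v).trans hz) s fun i => (hB₂z v).trans (hs i)
      _ = _ := by
          rw [Finset.sum_const, Finset.card_univ, Fintype.card_fin, nsmul_eq_mul]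
          push_cast
          field_simp
  have hdz : (d / z : ℝ) ≤ ε / 4 := by
    have hB₃0 : (0 : ℝ) < B₃ := lt_of_le_of_lt (by positivity) hB₃
    have h2 : (B₃ : ℝ) ≤ z := by exact_mod_cast (by omega : B₃ ≤ z)
    rw [div_lt_iff₀ (by positivity)] at hB₃
    rw [div_le_iff₀ (by linarith)]
    nlinarith
  rw [Finset.card_filter, Nat.cast_sum, sum_intBox_insertNth, card_intBox_insertNth]
  calc _ ≤ ∑ c ∈ intBox s, (2 * T + 1) * (d * truncRecipSum z (eval c Δ) +
        (if ∃ p : ℕ, p.Prime ∧ z < p ∧ ∀ k, (p : ℤ) ∣ eval c (P.coeff k) then 1 else 0) +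
          (d / z + ε / 4)) := by
        refine Finset.sum_le_sum fun c hcs => ?_
        refine le_trans (le_of_eq ?_) (hT c hcs)
        rw [← Nat.cast_sum, ← Finset.card_filter]
        simp only [hR]
    _ = (2 * T + 1) * (d * ∑ c ∈ intBox s, truncRecipSum z (eval c Δ) +
        ∑ c ∈ intBox s, (if ∃ p : ℕ, p.Prime ∧ z < p ∧ ∀ k, (p : ℤ) ∣ eval c (P.coeff k)
          then (1 : ℝ) else 0) + (d / z + ε / 4) * (intBox s).card) := by
        rw [← Finset.mul_sum, Finset.sum_add_distrib, Finset.sum_add_distrib, Finset.mul_sum,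
          Finset.sum_const, nsmul_eq_mul]
        ring
    _ ≤ (2 * T + 1) * (d * (ε / (4 * d) * (intBox s).card) + ε / 4 * (intBox s).card +
        (ε / 4 + ε / 4) * (intBox s).card) := by gcongr
    _ = _ := by field_simp; ring

/-! ### Densities in boxes -/

open Classical in
/-- The proportion of the points of a box which satisfy a predicate. -/
def boxRatio {ι : Type*} [Fintype ι] [DecidableEq ι] (G : (ι → ℤ) → Prop) (r : ι → ℕ) : ℝ :=
  ((intBox r).filter G).card / (intBox r).card

section Density

variable {ι : Type*} [Fintype ι] [DecidableEq ι]

lemma boxRatio_mono {G H : (ι → ℤ) → Prop} (h : ∀ x, G x → H x) (r : ι → ℕ) :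
    boxRatio G r ≤ boxRatio H r := by
  classical
  unfold boxRatio
  gcongr with x
  exact h x

lemma boxRatio_nonneg (G : (ι → ℤ) → Prop) (r : ι → ℕ) : 0 ≤ boxRatio G r := by
  unfold boxRatio; positivity

lemma boxRatio_le_add {G H K : (ι → ℤ) → Prop} (h : ∀ x, G x → H x ∨ K x) (r : ι → ℕ) :
    boxRatio G r ≤ boxRatio H r + boxRatio K r := by
  classical
  unfold boxRatio
  rw [← add_div]
  gcongr
  have hsub : (intBox r).filter G ⊆ (intBox r).filter H ∪ (intBox r).filter K := by
    intro x hx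
    obtain ⟨h1, h2⟩ := Finset.mem_filter.1 hx
    rw [Finset.mem_union, Finset.mem_filter, Finset.mem_filter]
    exact (h x h2).imp (fun h => ⟨h1, h⟩) fun h => ⟨h1, h⟩
  exact_mod_cast (Finset.card_le_card hsub).trans (Finset.card_union_le _ _)

lemma boxRatio_true (r : ι → ℕ) : boxRatio (fun _ : ι → ℤ => True) r = 1 := by
  classical
  unfold boxRatio
  rw [Finset.filter_true]
  exact div_self (card_intBox_pos r).ne'

lemma tendsto_card_modEq_div (q : ℕ) (hq : 0 < q) (a : ℤ) :
    Tendsto (fun M : ℕ => (((Finset.Icc (-(M : ℤ)) M).filter fun t => t ≡ a [ZMOD q]).card : ℝ) /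
      (2 * M + 1)) atTop (nhds (q : ℝ)⁻¹) := by
  have hlim : Tendsto (fun M : ℕ => (2 * (M : ℝ) + 1)⁻¹) atTop (nhds 0) := by
    refine tendsto_inv_atTop_zero.comp (tendsto_atTop_add_const_right _ _ ?_)
    exact tendsto_natCast_atTop_atTop.const_mul_atTop two_pos
  rw [tendsto_iff_norm_sub_tendsto_zero]
  refine squeeze_zero (fun _ => norm_nonneg _) (fun M => ?_) hlim
  have hM : (0 : ℝ) < 2 * M + 1 := by positivity
  have hq' : (0 : ℝ) < q := by exact_mod_cast hq
  have := abs_card_modEq_sub_le M q hq a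
  rw [Real.norm_eq_abs]
  set c : ℝ := (((Finset.Icc (-(M : ℤ)) M).filter fun t => t ≡ a [ZMOD q]).card : ℝ)
  have e : c / (2 * M + 1) - (q : ℝ)⁻¹ = (c - (2 * M + 1) / q) * (2 * (M : ℝ) + 1)⁻¹ := by
    field_simp
  rw [e, abs_mul, abs_of_pos (inv_pos.2 hM)]
  calc _ ≤ 1 * (2 * (M : ℝ) + 1)⁻¹ := by gcongr
    _ = _ := one_mul _

open Classical in
lemma tendsto_boxRatio_of_periodic (q : ℕ) [NeZero q] (G : (ι → ℤ) → Prop)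
    (hG : ∀ x y : ι → ℤ, (∀ i, x i ≡ y i [ZMOD q]) → G x → G y) :
    Tendsto (boxRatio G) atTop (nhds
      ((Finset.univ.filter fun a : ι → ZMod q => G fun i => (a i).val).card *
        ((q : ℝ)⁻¹) ^ Fintype.card ι)) := by
  have hq : 0 < q := Nat.pos_of_ne_zero (NeZero.ne q)
  have hfib : ∀ r : ι → ℕ, boxRatio G r =
      ∑ a ∈ Finset.univ.filter (fun a : ι → ZMod q => G fun i => (a i).val),
        ∏ i, ((((Finset.Icc (-(r i : ℤ)) (r i)).filter
          fun t => t ≡ ((a i).val : ℤ) [ZMOD q]).card : ℝ) / (2 * r i + 1)) := by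
    intro r
    unfold boxRatio
    have hval : ∀ (t : ℤ), t ≡ ((t : ZMod q).val : ℤ) [ZMOD q] := fun t => by
      rw [← ZMod.intCast_eq_intCast_iff]; simp
    rw [Finset.card_eq_sum_card_fiberwise (f := fun x i => (x i : ZMod q))
      (t := Finset.univ.filter (fun a : ι → ZMod q => G fun i => (a i).val))]
    · rw [Nat.cast_sum, Finset.sum_div]
      refine Finset.sum_congr rfl fun a ha => ?_
      have ha' := (Finset.mem_filter.1 ha).2
      have e : (((intBox r).filter G).filter fun x => (fun i => (x i : ZMod q)) = a) =
          Fintype.piFinset fun i => (Finset.Icc (-(r i : ℤ)) (r i)).filter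
            fun t => t ≡ ((a i).val : ℤ) [ZMOD q] := by
        ext x
        simp only [Finset.mem_filter, mem_intBox, Fintype.mem_piFinset, Finset.mem_Icc, ← abs_le]
        constructor
        · rintro ⟨⟨h1, -⟩, rfl⟩ i
          exact ⟨h1 i, hval _⟩
        · intro h
          refine ⟨⟨fun i => (h i).1, hG _ _ (fun i => (h i).2.symm) ha'⟩, ?_⟩
          ext i
          have := (ZMod.intCast_eq_intCast_iff _ _ _).2 (h i).2
          simpa using this
      rw [e, Fintype.card_piFinset, card_intBox, Finset.prod_div_distrib]
      push_cast
      rfl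
    · intro x hx
      have hx' := (Finset.mem_filter.1 hx).2
      simp only [Finset.coe_filter, Finset.mem_univ, true_and, Set.mem_ofPred_eq]
      exact hG _ _ (fun i => hval _) hx'
  rw [show boxRatio G = _ from funext hfib, ← nsmul_eq_mul, ← Finset.sum_const]
  refine tendsto_finsetSum _ fun a _ => ?_
  rw [← Finset.card_univ, ← Finset.prod_const]
  refine tendsto_finsetProd _ fun i _ => ?_
  refine (tendsto_card_modEq_div q hq _).comp (tendsto_atTop.2 fun b => ?_)
  filter_upwards [eventually_ge_atTop (fun _ => b)] with r hr using hr i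

/-- Sieving by infinitely many primes, with control of the contribution of large primes. -/
theorem exists_tendsto_boxRatio (ℱ : Filter (ι → ℕ)) [ℱ.NeBot] (hℱ : ℱ ≤ atTop)
    (Bad : ℕ → (ι → ℤ) → Prop) (e : ℕ)
    (hper : ∀ p x y, (∀ i, x i ≡ y i [ZMOD (p ^ e : ℕ)]) → Bad p x → Bad p y)
    (htail : ∀ ε > 0, ∃ z₀ : ℕ, ∀ z ≥ z₀, ∀ᶠ r in ℱ,
      boxRatio (fun x => ∃ p : ℕ, p.Prime ∧ z < p ∧ Bad p x) r ≤ ε)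
    (hne : ∃ x, ∀ p : ℕ, p.Prime → ¬ Bad p x) :
    ∃ L : ℝ, 0 < L ∧
      Tendsto (boxRatio fun x => ∀ p : ℕ, p.Prime → ¬ Bad p x) ℱ (nhds L) := by
  classical
  set q : ℕ → ℕ → ℕ := fun w z => ∏ p ∈ (Finset.Ioc w z).filter Nat.Prime, p ^ e with hq
  have hq0 : ∀ w z, q w z ≠ 0 := fun w z => Finset.prod_ne_zero_iff.2 fun p hp =>
    pow_ne_zero _ (Finset.mem_filter.1 hp).2.ne_zero
  have hdvd : ∀ {w z p}, p.Prime → w < p → p ≤ z → p ^ e ∣ q w z := fun hp h1 h2 =>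
    Finset.dvd_prod_of_mem _ (Finset.mem_filter.2 ⟨Finset.mem_Ioc.2 ⟨h1, h2⟩, hp⟩)
  set H : ℕ → ℕ → (ι → ℤ) → Prop := fun w z x => ∀ p : ℕ, p.Prime → w < p → p ≤ z → ¬ Bad p x
    with hH
  have hHper : ∀ w z (x y : ι → ℤ), (∀ i, x i ≡ y i [ZMOD q w z]) → H w z x → H w z y := by
    intro w z x y hxy hx p hp h1 h2 hb
    refine hx p hp h1 h2 (hper p y x (fun i => ?_) hb)
    exact ((hxy i).of_dvd (by exact_mod_cast hdvd hp h1 h2)).symm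
  have hlim : ∀ w z, ∃ δ, Tendsto (boxRatio (H w z)) atTop (nhds δ) := fun w z =>
    haveI : NeZero (q w z) := ⟨hq0 w z⟩
    ⟨_, tendsto_boxRatio_of_periodic (q w z) (H w z) (hHper w z)⟩
  choose δ hδ using hlim
  have hanti : Antitone (δ 0) := fun z z' hz =>
    le_of_tendsto_of_tendsto' (hδ 0 z') (hδ 0 z) fun r =>
      boxRatio_mono (fun x hx p hp h1 h2 => hx p hp h1 (h2.trans hz)) r
  have hbdd : BddBelow (Set.range (δ 0)) := ⟨0, by
    rintro _ ⟨z, rfl⟩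
    exact ge_of_tendsto' (hδ 0 z) fun r => boxRatio_nonneg _ r⟩
  have hL := tendsto_atTop_ciInf hanti hbdd
  set L := ⨅ z, δ 0 z
  refine ⟨L, ?_, ?_⟩
  · obtain ⟨x₀, hx₀⟩ := hne
    obtain ⟨w, hw⟩ := htail (1 / 2) (by norm_num)
    have hhalf : ∀ z, 1 / 2 ≤ δ w z := by
      intro z
      refine ge_of_tendsto ((hδ w z).mono_left hℱ) ?_
      filter_upwards [hw w le_rfl] with r hr
      have := boxRatio_le_add (G := fun _ => True) (H := H w z)
        (K := fun x => ∃ p : ℕ, p.Prime ∧ w < p ∧ Bad p x) (fun x _ => by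
          by_cases h : H w z x
          · exact Or.inl h
          · simp only [hH] at h
            push Not at h
            obtain ⟨p, hp, h1, -, h2⟩ := h
            exact Or.inr ⟨p, hp, h1, h2⟩) r
      rw [boxRatio_true] at this
      linarith
    have hlow : ∀ z, δ w z * ((q 0 w : ℝ)⁻¹) ^ Fintype.card ι ≤ δ 0 z := by
      intro z
      have i1 : NeZero (q 0 w) := ⟨hq0 0 w⟩
      have i2 : NeZero (q w z) := ⟨hq0 w z⟩
      have hcop : Nat.Coprime (q 0 w) (q w z) := by
        refine Nat.Coprime.prod_left fun p hp => Nat.Coprime.prod_right fun p' hp' => ?_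
        obtain ⟨h1, h2⟩ := Finset.mem_filter.1 hp
        obtain ⟨h3, h4⟩ := Finset.mem_filter.1 hp'
        rw [Finset.mem_Ioc] at h1 h3
        exact Nat.Coprime.pow _ _ ((Nat.coprime_primes h2 h4).2 (by omega))
      set G : (ι → ℤ) → Prop := fun x => (∀ i, x i ≡ x₀ i [ZMOD q 0 w]) ∧ H w z x
      have hGper : ∀ x y : ι → ℤ, (∀ i, x i ≡ y i [ZMOD (q 0 w * q w z : ℕ)]) → G x → G y := by
        intro x y hxy hx
        refine ⟨fun i => ?_, hHper w z x y (fun i => (hxy i).of_dvd ?_) hx.2⟩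
        · exact ((hxy i).of_dvd (by push_cast; exact dvd_mul_right _ _)).symm.trans (hx.1 i)
        · push_cast; exact dvd_mul_left _ _
      have i3 : NeZero (q 0 w * q w z) := ⟨mul_ne_zero (hq0 0 w) (hq0 w z)⟩
      have t1 := tendsto_boxRatio_of_periodic (q 0 w * q w z) G hGper
      have t2 := tendsto_boxRatio_of_periodic (q w z) (H w z) (hHper w z)
      have hle := le_of_tendsto_of_tendsto' t1 (hδ 0 z) fun r => boxRatio_mono (by
        intro x hx p hp h1 h2 hb
        by_cases hpw : p ≤ w
        · refine hx₀ p hp (hper p x x₀ (fun i => ?_) hb)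
          exact (hx.1 i).of_dvd (by exact_mod_cast hdvd hp h1 hpw)
        · exact hx.2 p hp (not_le.1 hpw) h2 hb) r
      rw [tendsto_nhds_unique (hδ w z) t2]
      refine le_trans ?_ hle
      push_cast
      rw [mul_assoc, ← mul_pow, ← mul_inv, mul_comm (q w z : ℝ)]
      gcongr
      let φ := ZMod.chineseRemainder hcop
      have hφ1 : ∀ b : ZMod (q 0 w * q w z), (φ b).1 = ((b.val : ℤ) : ZMod (q 0 w)) := by
        intro b
        have : φ b = φ ((b.val : ℤ) : ZMod (q 0 w * q w z)) := by simp
        rw [this, map_intCast]; rfl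
      have hφ2 : ∀ b : ZMod (q 0 w * q w z), (φ b).2 = ((b.val : ℤ) : ZMod (q w z)) := by
        intro b
        have : φ b = φ ((b.val : ℤ) : ZMod (q 0 w * q w z)) := by simp
        rw [this, map_intCast]; rfl
      refine Finset.card_le_card_of_injOn
        (fun a i => φ.symm ((x₀ i : ZMod (q 0 w)), a i)) ?_ ?_
      · intro a ha
        have ha' := (Finset.mem_filter.1 ha).2
        simp only [Finset.coe_filter, Finset.mem_univ, true_and, Set.mem_ofPred_eq]
        refine ⟨fun i => ?_, hHper w z _ _ (fun i => ?_) ha'⟩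
        · rw [← ZMod.intCast_eq_intCast_iff, ← hφ1, RingEquiv.apply_symm_apply]
        · rw [← ZMod.intCast_eq_intCast_iff, ← hφ2, RingEquiv.apply_symm_apply]
          simp
      · intro a _ b _ hab
        ext i
        have := congrFun hab i
        simp only [EmbeddingLike.apply_eq_iff_eq, Prod.mk.injEq, true_and] at this
        exact this
    have hpos : (0 : ℝ) < 1 / 2 * ((q 0 w : ℝ)⁻¹) ^ Fintype.card ι := by
      have : (0 : ℝ) < q 0 w := by exact_mod_cast Nat.pos_of_ne_zero (hq0 0 w)
      positivity
    refine hpos.trans_le (le_ciInf fun z => le_trans ?_ (hlow z))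
    gcongr
    exact hhalf z
  · rw [Metric.tendsto_nhds]
    intro ε hε
    obtain ⟨w, hw⟩ := htail (ε / 3) (by positivity)
    obtain ⟨z, hz1, hz2⟩ := ((Metric.tendsto_nhds.1 hL (ε / 3) (by positivity)).and
      (eventually_ge_atTop w)).exists
    filter_upwards [hw z hz2, Metric.tendsto_nhds.1 ((hδ 0 z).mono_left hℱ) (ε / 3)
      (by positivity)] with r h1 h2
    rw [Real.dist_eq] at hz1 h2 ⊢
    have u1 : boxRatio (fun x => ∀ p : ℕ, p.Prime → ¬ Bad p x) r ≤ boxRatio (H 0 z) r :=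
      boxRatio_mono (fun x hx p hp _ _ => hx p hp) r
    have u2 := boxRatio_le_add (G := H 0 z) (H := fun x => ∀ p : ℕ, p.Prime → ¬ Bad p x)
      (K := fun x => ∃ p : ℕ, p.Prime ∧ z < p ∧ Bad p x) (fun x hx => by
        by_cases h : ∃ p : ℕ, p.Prime ∧ z < p ∧ Bad p x
        · exact Or.inr h
        · push Not at h
          refine Or.inl fun p hp => ?_
          by_cases hpz : p ≤ z
          · exact hx p hp hp.pos hpz
          · exact h p hp (not_le.1 hpz)) r
    rw [abs_lt] at hz1 h2 ⊢
    constructor <;> linarith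

end Density

/-! ### The resultant of two binary forms of the same degree -/

section Resultant

variable {R S : Type*} [CommRing R] [CommRing S] (d : ℕ)

lemma map_sylvesterMat (φ : R →+* S) (Q : Fin (2 * d + 2) → R) :
    φ.mapMatrix (sylvesterMat d Q) = sylvesterMat d fun i => φ (Q i) := by
  ext i j
  simp only [sylvesterMat, RingHom.mapMatrix_apply, Matrix.map_apply, Matrix.of_apply]
  split_ifs <;> simp

lemma resEval_eq_det (Q : Fin (2 * d + 2) → R) : resEval d Q = (sylvesterMat d Q).det := by
  have h := map_sylvesterMat d (aeval Q : MvPolynomial (Fin (2 * d + 2)) ℤ →ₐ[ℤ] R).toRingHom X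
  rw [resEval, resPoly]
  change (aeval Q : MvPolynomial (Fin (2 * d + 2)) ℤ →ₐ[ℤ] R).toRingHom _ = _
  rw [RingHom.map_det, h]
  congr 2
  ext i
  exact aeval_X Q i

lemma map_resEval (φ : R →+* S) (Q : Fin (2 * d + 2) → R) :
    φ (resEval d Q) = resEval d fun i => φ (Q i) := by
  rw [resEval_eq_det, resEval_eq_det, RingHom.map_det, map_sylvesterMat]

lemma resEval_const_mul (a : R) (Q : Fin (2 * d + 2) → R) :
    (resEval d fun i => a * Q i) = a ^ (2 * d) * resEval d Q := by
  have : (sylvesterMat d fun i => a * Q i) = a • sylvesterMat d Q := by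
    ext i j
    simp only [sylvesterMat, Matrix.smul_apply, Matrix.of_apply, smul_eq_mul]
    split_ifs <;> simp
  rw [resEval_eq_det, resEval_eq_det, this, Matrix.det_smul, Fintype.card_fin]

/-- The tuple of the coefficients up to degree `d` of two polynomials. -/
def coeffPair (f g : Polynomial R) : Fin (2 * d + 2) → R := fun k =>
  if (k : ℕ) < d + 1 then f.coeff k else g.coeff (k - (d + 1))

lemma resEval_coeffPair (f g : Polynomial R) :
    resEval d (coeffPair d f g) = g.resultant f d d := by
  have e : d + d = 2 * d := (two_mul d).symm
  rw [resEval_eq_det, Polynomial.resultant, ← Matrix.det_transpose (sylvesterMat d _),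
    ← Matrix.det_reindex_self (finCongr e) (Polynomial.sylvester g f d d)]
  congr 1
  ext i j
  obtain ⟨j, rfl⟩ := (finCongr e).surjective j
  simp only [Matrix.transpose_apply, Matrix.reindex_apply, Matrix.submatrix_apply,
    Equiv.symm_apply_apply, sylvesterMat, Matrix.of_apply, Polynomial.sylvester]
  induction j using Fin.addCases with
  | left j =>
    have hj := j.2
    simp only [Fin.addCases_left, Set.mem_Icc, finCongr_apply, Fin.val_cast, Fin.val_castAdd,
      finCongr_symm, dif_pos hj]
    split_ifs with h
    · rw [coeffPair, if_pos (by simp only; omega)]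
    · rfl
  | right j =>
    have hj : ¬ d + (j : ℕ) < d := by omega
    simp only [Fin.addCases_right, Set.mem_Icc, finCongr_apply, Fin.val_cast, Fin.val_natAdd,
      finCongr_symm, dif_neg hj]
    by_cases h : (j : ℕ) ≤ i ∧ (i : ℕ) ≤ j + d
    · rw [if_pos h, dif_pos (by omega), coeffPair, if_neg (by simp only; omega)]
      congr 1
      simp only
      omega
    · rw [if_neg h, dif_neg (by omega)]

lemma resEval_coeffPair_comm (f g : Polynomial R) :
    resEval d (coeffPair d f g) = (-1) ^ (d * d) * resEval d (coeffPair d g f) := by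
  rw [resEval_coeffPair, resEval_coeffPair, Polynomial.resultant_comm]

/-- The coefficients of two polynomials, the first one being that with a coefficient in
position `n`. -/
def slotPair (n : Fin (2 * d + 2)) (f g : Polynomial R) : Fin (2 * d + 2) → R :=
  if (n : ℕ) < d + 1 then coeffPair d f g else coeffPair d g f

/-- The degree of the monomial whose coefficient is in position `n`. -/
def slotIndex (n : Fin (2 * d + 2)) : ℕ := if (n : ℕ) < d + 1 then n else n - (d + 1)

lemma slotIndex_le (n : Fin (2 * d + 2)) : slotIndex d n ≤ d := by
  unfold slotIndex; split_ifs <;> omega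

lemma update_slotPair (n : Fin (2 * d + 2)) (f g : Polynomial R) (t : R) :
    Function.update (slotPair d n f g) n t = slotPair d n
      (f + Polynomial.monomial (slotIndex d n) (t - f.coeff (slotIndex d n))) g := by
  ext k
  unfold slotPair slotIndex
  by_cases h : (n : ℕ) < d + 1
  · simp only [if_pos h]
    rcases eq_or_ne k n with rfl | hk
    · simp [coeffPair, h]
    · have hk' : (n : ℕ) ≠ k := fun h => hk (Fin.ext h.symm)
      simp [coeffPair, Function.update_of_ne hk, Polynomial.coeff_monomial, hk']
  · simp only [if_neg h]
    rcases eq_or_ne k n with rfl | hk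
    · simp only [coeffPair, if_neg h, Function.update_self]
      simp
    · have hk' : (n : ℕ) ≠ k := fun h => hk (Fin.ext h.symm)
      rw [Function.update_of_ne hk]
      unfold coeffPair
      split_ifs with h1
      · rfl
      · have : ¬ (n : ℕ) - (d + 1) = k - (d + 1) := by omega
        simp [Polynomial.coeff_monomial, this]

lemma exists_resEval_slotPair (n : Fin (2 * d + 2)) : ∃ u : ℤ, IsUnit u ∧
    ∀ {R : Type*} [CommRing R] (f g : Polynomial R),
      resEval d (slotPair d n f g) = u * g.resultant f d d := by
  by_cases h : (n : ℕ) < d + 1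
  · refine ⟨1, isUnit_one, fun f g => ?_⟩
    rw [slotPair, if_pos h, resEval_coeffPair, Int.cast_one, one_mul]
  · refine ⟨(-1) ^ (d * d), isUnit_one.neg.pow _, fun f g => ?_⟩
    rw [slotPair, if_neg h, resEval_coeffPair_comm, resEval_coeffPair]
    push_cast
    rfl

lemma exists_eq_slotPair (n : Fin (2 * d + 2)) (Q : Fin (2 * d + 2) → R) :
    ∃ f g : Polynomial R, f.natDegree ≤ d ∧ g.natDegree ≤ d ∧ Q = slotPair d n f g := by
  set f : Polynomial R := ∑ i : Fin (d + 1), Polynomial.monomial i (Q ⟨i, by omega⟩) with hf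
  set g : Polynomial R := ∑ i : Fin (d + 1), Polynomial.monomial i (Q ⟨d + 1 + i, by omega⟩) with hg
  have hfd : f.natDegree ≤ d := Polynomial.natDegree_sum_le_of_forall_le _ _ fun i _ =>
    (Polynomial.natDegree_monomial_le _).trans (by omega)
  have hgd : g.natDegree ≤ d := Polynomial.natDegree_sum_le_of_forall_le _ _ fun i _ =>
    (Polynomial.natDegree_monomial_le _).trans (by omega)
  have key : Q = coeffPair d f g := by
    ext k
    unfold coeffPair
    split_ifs with h
    · rw [hf, Polynomial.finsetSum_coeff, Finset.sum_eq_single ⟨k, h⟩]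
      · simp
      · intro b _ hb
        rw [Polynomial.coeff_monomial, if_neg fun h' => hb (Fin.ext h')]
      · simp
    · rw [hg, Polynomial.finsetSum_coeff, Finset.sum_eq_single ⟨k - (d + 1), by omega⟩]
      · have : d + 1 + ((k : ℕ) - (d + 1)) = k := by omega
        simp [this]
      · intro b _ hb
        rw [Polynomial.coeff_monomial, if_neg fun h' => hb (Fin.ext h')]
      · simp
  by_cases h : (n : ℕ) < d + 1
  · exact ⟨f, g, hfd, hgd, by rw [slotPair, if_pos h, key]⟩
  · exact ⟨g, f, hgd, hfd, by rw [slotPair, if_neg h, key]⟩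

lemma exists_slotPair_apply (n : Fin (2 * d + 2)) (k : ℕ) (hk : k ≤ d) :
    ∃ j ≠ n, ∀ {R : Type*} [CommRing R] (f g : Polynomial R), slotPair d n f g j = g.coeff k := by
  by_cases h : (n : ℕ) < d + 1
  · refine ⟨⟨d + 1 + k, by omega⟩, fun h' => ?_, fun f g => ?_⟩
    · have := congrArg Fin.val h'
      simp only at this
      omega
    · rw [slotPair, if_pos h, coeffPair, if_neg (by simp only; omega)]
      simp
  · refine ⟨⟨k, by omega⟩, fun h' => ?_, fun f g => ?_⟩
    · have := congrArg Fin.val h'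
      simp only at this
      omega
    · rw [slotPair, if_neg h, coeffPair, if_pos (by simp only; omega)]

/-- If the resultant vanishes identically in the `n`-th coefficient, then another coefficient
is zero. -/
lemma exists_eq_zero_of_forall_resEval_update {K : Type*} [Field K] [Infinite K]
    (n : Fin (2 * d + 2)) (Q : Fin (2 * d + 2) → K)
    (h : ∀ t, resEval d (Function.update Q n t) = 0) : ∃ j ≠ n, Q j = 0 := by
  obtain ⟨f, g, hf, hg, rfl⟩ := exists_eq_slotPair d n Q
  obtain ⟨u, hu, hres⟩ := exists_resEval_slotPair d n
  set i := slotIndex d n with hi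
  have hid : i ≤ d := slotIndex_le d n
  set f₀ := f - Polynomial.monomial i (f.coeff i) with hf₀
  have hu0 : (u : K) ≠ 0 := (hu.map (Int.castRingHom K)).ne_zero
  have h1 : ∀ t, g.resultant (f₀ + Polynomial.monomial i t) d d = 0 := by
    intro t
    have := h t
    rw [update_slotPair, hres] at this
    have e : f + Polynomial.monomial i (t - f.coeff i) = f₀ + Polynomial.monomial i t := by
      rw [hf₀, Polynomial.monomial_sub]; ring
    rw [e] at this
    exact (mul_eq_zero.1 this).resolve_left hu0
  set W : Polynomial K := (g.map Polynomial.C).resultant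
    (Polynomial.C Polynomial.X * f₀.map Polynomial.C + Polynomial.X ^ i) d d with hW
  have hWe : ∀ s : K, W.eval s = g.resultant (Polynomial.C s * f₀ + Polynomial.X ^ i) d d := by
    intro s
    rw [← Polynomial.coe_evalRingHom, hW, ← Polynomial.resultant_map_map]
    congr 1
    · rw [Polynomial.map_map]
      convert Polynomial.map_id
      ext; simp
    · simp only [Polynomial.map_add, Polynomial.map_mul, Polynomial.map_C, Polynomial.map_pow,
        Polynomial.map_X, Polynomial.map_map, Polynomial.coe_evalRingHom, Polynomial.eval_X]
      congr 2
      convert Polynomial.map_id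
      ext; simp
  have hW0 : ∀ s : K, s ≠ 0 → W.eval s = 0 := by
    intro s hs
    have e : Polynomial.C s * f₀ + Polynomial.X ^ i =
        Polynomial.C s * (f₀ + Polynomial.monomial i s⁻¹) := by
      rw [mul_add, Polynomial.C_mul_monomial, mul_inv_cancel₀ hs, Polynomial.X_pow_eq_monomial]
    rw [hWe, e, Polynomial.resultant_C_mul_right, h1, mul_zero]
  have hWz : W = 0 := by
    refine Polynomial.eq_zero_of_infinite_isRoot W ?_
    exact (Set.finite_singleton (0 : K)).infinite_compl.mono fun s hs => hW0 s hs
  have h0 := hWe 0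
  rw [hWz, Polynomial.eval_zero, Polynomial.C_0, zero_mul, zero_add] at h0
  have hdi : g.resultant (Polynomial.X ^ i) d d =
      g.coeff d ^ (d - i) * ((-1) ^ (d * i) * g.coeff 0 ^ i) := by
    rw [← Polynomial.resultant_X_pow_right g d i hg]
    have := Polynomial.resultant_add_right_deg g (Polynomial.X ^ i) d i (d - i)
      (Polynomial.natDegree_X_pow_le i)
    rwa [Nat.add_sub_cancel' hid] at this
  rw [hdi] at h0
  have h3 : g.coeff d = 0 ∨ g.coeff 0 = 0 := by
    by_contra! hcon
    exact mul_ne_zero (pow_ne_zero _ hcon.1) (mul_ne_zero (pow_ne_zero _ (by simp))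
      (pow_ne_zero _ hcon.2)) h0.symm
  rcases h3 with h3 | h3
  · obtain ⟨j, hj, hjn⟩ := exists_slotPair_apply d n d le_rfl
    exact ⟨j, hj, (hjn f g).trans h3⟩
  · obtain ⟨j, hj, hjn⟩ := exists_slotPair_apply d n 0 (Nat.zero_le d)
    exact ⟨j, hj, (hjn f g).trans h3⟩

/-- The resultant takes a unit value at a point whose `v`-th coordinate vanishes. -/
lemma exists_isUnit_resEval (hd : d ≠ 0) (v : Fin (2 * d + 2)) :
    ∃ Q : Fin (2 * d + 2) → ℤ, Q v = 0 ∧ IsUnit (resEval d Q) := by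
  have h1 : IsUnit (resEval d (coeffPair d (Polynomial.X ^ d) (1 : Polynomial ℤ))) := by
    rw [resEval_coeffPair, Polynomial.resultant_X_pow_right _ _ _ (by simp)]
    simp only [Polynomial.coeff_one_zero, one_pow, mul_one]
    exact isUnit_one.neg.pow _
  have h2 : IsUnit (resEval d (coeffPair d (1 : Polynomial ℤ) (Polynomial.X ^ d))) := by
    rw [resEval_coeffPair, Polynomial.resultant_X_pow_left _ _ _ (by simp)]
    simp
  by_cases hv : (v : ℕ) = d ∨ (v : ℕ) = d + 1
  · refine ⟨_, ?_, h2⟩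
    unfold coeffPair
    rcases hv with hv | hv <;>
      simp [hv, Polynomial.coeff_one, Polynomial.coeff_X_pow, hd, hd.symm]
  · refine ⟨_, ?_, h1⟩
    push Not at hv
    unfold coeffPair
    split_ifs with h
    · simp [Polynomial.coeff_X_pow, hv.1]
    · rw [Polynomial.coeff_one, if_neg (by omega)]

end Resultant

/-! ### The resultant as a polynomial in one of its variables -/

section ResultantInOneVariable

variable (d : ℕ) (n : Fin (2 * d + 2))

/-- The generic resultant, as a polynomial in its `n`-th variable. -/
def resSlotPoly : Polynomial (MvPolynomial (Fin (2 * d + 1)) ℤ) :=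
  resEval d (Fin.insertNth n Polynomial.X fun j => Polynomial.C (X j) :
    Fin (2 * d + 2) → Polynomial (MvPolynomial (Fin (2 * d + 1)) ℤ))

lemma eval_map_resSlotPoly {R : Type*} [CommRing R] (φ : MvPolynomial (Fin (2 * d + 1)) ℤ →+* R)
    (t : R) : ((resSlotPoly d n).map φ).eval t =
      resEval d (Fin.insertNth n t fun j => φ (X j) : Fin (2 * d + 2) → R) := by
  have h := map_resEval d ((Polynomial.evalRingHom t).comp (Polynomial.mapRingHom φ))
    (Fin.insertNth n Polynomial.X fun j => Polynomial.C (X j) :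
      Fin (2 * d + 2) → Polynomial (MvPolynomial (Fin (2 * d + 1)) ℤ))
  rw [RingHom.comp_apply, Polynomial.coe_mapRingHom, Polynomial.coe_evalRingHom] at h
  rw [resSlotPoly, h]
  congr 1
  ext k
  induction k using Fin.succAboveCases n <;> simp

lemma natDegree_resSlotPoly_le : (resSlotPoly d n).natDegree ≤ d := by
  set Q : Fin (2 * d + 2) → Polynomial (MvPolynomial (Fin (2 * d + 1)) ℤ) :=
    Fin.insertNth n Polynomial.X fun j => Polynomial.C (X j) with hQ
  have hQd : ∀ k, (Q k).natDegree ≤ if k = n then 1 else 0 := by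
    intro k
    induction k using Fin.succAboveCases n with
    | x => simp [hQ]
    | p k => simp [hQ]
  set b : ℕ → ℕ := fun i => if i < d ↔ (n : ℕ) < d + 1 then 1 else 0 with hb
  have hentry : ∀ i j, (sylvesterMat d Q i j).natDegree ≤ b i := by
    intro i j
    simp only [sylvesterMat, Matrix.of_apply]
    split_ifs with h1 h2 h2
    · refine (hQd _).trans ?_
      split_ifs with h3
      · have := congrArg Fin.val h3
        simp only at this
        simp only [hb]
        rw [if_pos]
        exact iff_of_true h1 (by omega)
      · exact Nat.zero_le _
    · simp
    · refine (hQd _).trans ?_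
      split_ifs with h3
      · have := congrArg Fin.val h3
        simp only at this
        simp only [hb]
        rw [if_pos]
        exact iff_of_false h1 (by omega)
      · exact Nat.zero_le _
    · simp
  have hsum : ∑ i : Fin (2 * d), b i = d := by
    have h1 : ∑ i ∈ Finset.range d, b i = if (n : ℕ) < d + 1 then d else 0 := by
      rw [Finset.sum_congr rfl fun i hi => if_congr
        (iff_iff_eq.2 (by rw [eq_true (Finset.mem_range.1 hi), true_iff])) rfl rfl]
      split_ifs <;> simp
    have h2 : ∑ i ∈ Finset.range d, b (d + i) = if (n : ℕ) < d + 1 then 0 else d := by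
      have : ∀ i, b (d + i) = if (n : ℕ) < d + 1 then 0 else 1 := by
        intro i
        simp only [hb]
        split_ifs <;> first | rfl | omega
      simp only [this]
      split_ifs <;> simp
    rw [Fin.sum_univ_eq_sum_range b, two_mul, Finset.sum_range_add, h1, h2]
    split_ifs <;> simp
  rw [resSlotPoly, ← hQ, resEval_eq_det, Matrix.det_apply]
  refine Polynomial.natDegree_sum_le_of_forall_le _ _ fun σ _ => ?_
  refine (Polynomial.natDegree_smul_le _ _).trans ((Polynomial.natDegree_prod_le _ _).trans ?_)
  calc ∑ i, (sylvesterMat d Q (σ i) i).natDegree ≤ ∑ i, b (σ i) :=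
        Finset.sum_le_sum fun i _ => hentry _ _
    _ = d := by rw [Equiv.sum_comp σ fun i : Fin (2 * d) => b i, hsum]

lemma exists_dvd_of_dvd_coeff_resSlotPoly (c : Fin (2 * d + 1) → ℤ) {p : ℕ} (hp : p.Prime)
    (h : ∀ k, (p : ℤ) ∣ eval c ((resSlotPoly d n).coeff k)) : ∃ v, (p : ℤ) ∣ c v := by
  have := Fact.mk hp
  let K := AlgebraicClosure (ZMod p)
  have : CharP K p := charP_of_injective_algebraMap (algebraMap (ZMod p) K).injective p
  have : Infinite K := IsAlgClosed.instInfinite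
  let φ : MvPolynomial (Fin (2 * d + 1)) ℤ →+* K := (Int.castRingHom K).comp (eval c)
  have hmap : (resSlotPoly d n).map φ = 0 := by
    ext k
    rw [Polynomial.coeff_map, Polynomial.coeff_zero]
    exact (CharP.intCast_eq_zero_iff K p _).2 (h k)
  obtain ⟨j, hj, hjv⟩ := exists_eq_zero_of_forall_resEval_update d n
    (Fin.insertNth n 0 fun j => φ (X j) : Fin (2 * d + 2) → K) fun t => by
      rw [Fin.update_insertNth, ← eval_map_resSlotPoly, hmap, Polynomial.eval_zero]
  obtain ⟨v, rfl⟩ := Fin.exists_succAbove_eq hj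
  refine ⟨v, ?_⟩
  rw [Fin.insertNth_apply_succAbove] at hjv
  simpa [φ, CharP.intCast_eq_zero_iff K p] using hjv

lemma exists_eval_coeff_resSlotPoly_ne_zero (hd : d ≠ 0) (v : Fin (2 * d + 1)) :
    ∃ k c, c v = 0 ∧ eval c ((resSlotPoly d n).coeff k) ≠ 0 := by
  obtain ⟨Q, hQ, hu⟩ := exists_isUnit_resEval d hd (n.succAbove v)
  by_contra! hcon
  have h0 : (resSlotPoly d n).map (eval (n.removeNth Q)) = 0 := by
    ext k
    rw [Polynomial.coeff_map, Polynomial.coeff_zero]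
    exact hcon k _ hQ
  have h1 := eval_map_resSlotPoly d n (eval (n.removeNth Q)) (Q n)
  simp only [h0, Polynomial.eval_zero, eval_X] at h1
  rw [Fin.insertNth_self_removeNth] at h1
  exact hu.ne_zero h1.symm

lemma exists_separable_resSlotPoly (hd : 2 ≤ d) :
    ∃ φ : MvPolynomial (Fin (2 * d + 1)) ℤ →+* ℚ, ((resSlotPoly d n).map φ).Separable ∧
      ((resSlotPoly d n).map φ).natDegree = d := by
  set i := slotIndex d n with hi
  have hid : i ≤ d := slotIndex_le d n
  obtain ⟨i', hi'i, hi'd, hi'⟩ : ∃ i' ≠ i, i' ≤ d ∧ (i' = 0 ∨ i = 0 ∧ i' = 1) := by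
    rcases Nat.eq_zero_or_pos i with h | h
    · exact ⟨1, by omega, by omega, Or.inr ⟨h, rfl⟩⟩
    · exact ⟨0, by omega, by omega, Or.inl rfl⟩
  let g : Polynomial ℚ := ∏ j : Fin d, (Polynomial.X - Polynomial.C ((j : ℚ) + 1))
  have hgd : g.natDegree = d := by
    rw [Polynomial.natDegree_prod_of_monic _ _ fun j _ => Polynomial.monic_X_sub_C _]
    simp only [Polynomial.natDegree_X_sub_C, Finset.sum_const, Finset.card_fin, smul_eq_mul,
      mul_one]
  obtain ⟨u, hu, hres⟩ := exists_resEval_slotPair d n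
  have hu0 : (u : ℚ) ≠ 0 := (hu.map (Int.castRingHom ℚ)).ne_zero
  set Q := slotPair d n (Polynomial.X ^ i' : Polynomial ℚ) g with hQ
  have hj0 : ∀ j : Fin d, (j : ℚ) + 1 ≠ 0 := fun j => by positivity
  let φ : MvPolynomial (Fin (2 * d + 1)) ℤ →+* ℚ := eval₂Hom (Int.castRingHom ℚ) (n.removeNth Q)
  have key : (resSlotPoly d n).map φ =
      Polynomial.C (u * ∏ j : Fin d, ((j : ℚ) + 1) ^ i) *
        ∏ j : Fin d, (Polynomial.X - Polynomial.C (-(((j : ℚ) + 1) ^ i' / ((j : ℚ) + 1) ^ i))) := by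
    refine Polynomial.funext fun t => ?_
    rw [eval_map_resSlotPoly]
    have hX : (fun j => φ (X j)) = n.removeNth Q := funext fun j => eval₂Hom_X' _ _ j
    rw [hX, Fin.insertNth_removeNth, hQ, update_slotPair, hres, ← hi]
    have hdeg : (Polynomial.X ^ i' + Polynomial.monomial i
        (t - (Polynomial.X ^ i' : Polynomial ℚ).coeff i)).natDegree ≤ d :=
      Polynomial.natDegree_add_le_of_degree_le ((Polynomial.natDegree_X_pow_le _).trans hi'd)
        ((Polynomial.natDegree_monomial_le _).trans hid)
    have hprod := Polynomial.resultant_prod_left Finset.univ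
      (fun j : Fin d => Polynomial.X - Polynomial.C ((j : ℚ) + 1)) _ d
      (Finset.prod_ne_zero_iff.2 fun j _ => by
        rw [Polynomial.leadingCoeff_X_sub_C]; exact one_ne_zero) hdeg
    have e : (∏ j : Fin d, (Polynomial.X - Polynomial.C ((j : ℚ) + 1))).natDegree = d := hgd
    rw [e] at hprod
    rw [hprod]
    simp only [Polynomial.natDegree_X_sub_C, Polynomial.resultant_X_sub_C_left _ _ _ hdeg]
    rw [Polynomial.eval_mul, Polynomial.eval_C, Polynomial.eval_prod, mul_assoc,
      ← Finset.prod_mul_distrib]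
    congr 1
    refine Finset.prod_congr rfl fun j _ => ?_
    have := pow_ne_zero i (hj0 j)
    simp only [Polynomial.coeff_X_pow, if_neg hi'i.symm, Polynomial.eval_add, Polynomial.eval_pow,
      Polynomial.eval_X, Polynomial.eval_monomial, Polynomial.eval_sub, Polynomial.eval_C]
    field_simp
    ring
  have ha : (u * ∏ j : Fin d, ((j : ℚ) + 1) ^ i) ≠ 0 :=
    mul_ne_zero hu0 (Finset.prod_ne_zero_iff.2 fun j _ => pow_ne_zero _ (hj0 j))
  refine ⟨φ, ?_, ?_⟩
  · rw [key]
    refine Polynomial.Separable.unit_mul (Polynomial.isUnit_C.2 ha.isUnit) ?_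
    rw [Polynomial.separable_prod_X_sub_C_iff]
    intro j k hjk
    simp only [neg_inj] at hjk
    rw [div_eq_div_iff (pow_ne_zero _ (hj0 j)) (pow_ne_zero _ (hj0 k))] at hjk
    have hnat : ((j : ℕ) + 1) ^ i' * ((k : ℕ) + 1) ^ i = ((k : ℕ) + 1) ^ i' * ((j : ℕ) + 1) ^ i := by
      exact_mod_cast hjk
    rcases hi' with h | ⟨h, h'⟩
    · rw [h, pow_zero, pow_zero, one_mul, one_mul] at hnat
      have := Nat.pow_left_injective (by omega : i ≠ 0) hnat
      exact Fin.ext (by omega)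
    · rw [h, h', pow_one, pow_one, pow_zero, pow_zero] at hnat
      exact Fin.ext (by omega)
  · rw [key, Polynomial.natDegree_C_mul ha,
      Polynomial.natDegree_prod_of_monic _ _ fun j _ => Polynomial.monic_X_sub_C _]
    simp only [Polynomial.natDegree_X_sub_C, Finset.sum_const, Finset.card_fin, smul_eq_mul,
      mul_one]

/-- The resultant is coprime to its derivative with respect to the `n`-th variable. -/
lemma exists_mul_resSlotPoly_add_mul_derivative (hd : 2 ≤ d) :
    ∃ (U V : Polynomial (MvPolynomial (Fin (2 * d + 1)) ℤ)) (Δ : MvPolynomial (Fin (2 * d + 1)) ℤ),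
      Δ ≠ 0 ∧ U * resSlotPoly d n + V * (resSlotPoly d n).derivative = Polynomial.C Δ := by
  set P := resSlotPoly d n with hP
  have hdeg : P.natDegree ≤ d := natDegree_resSlotPoly_le d n
  obtain ⟨U, V, -, -, hUV⟩ := Polynomial.exists_mul_add_mul_eq_C_resultant P P.derivative hdeg
    ((Polynomial.natDegree_derivative_le P).trans (Nat.sub_le_sub_right hdeg 1)) (by omega)
  refine ⟨U, V, _, fun h0 => ?_, by rw [← hUV]; ring⟩
  obtain ⟨φ, hsep, hnd⟩ := exists_separable_resSlotPoly d n hd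
  have h1 := Polynomial.resultant_ne_zero _ _ hsep
  rw [Polynomial.natDegree_derivative, hnd, Polynomial.derivative_map,
    Polynomial.resultant_map_map, ← hP, h0, map_zero] at h1
  exact h1 rfl

open Classical in
/-- Box points whose resultant is divisible by the `d`-th power of a large prime are rare. -/
lemma eventually_card_large_prime_resEval_le (hd : 2 ≤ d) {ε : ℝ} (hε : 0 < ε) :
    ∃ z₀ : ℕ, ∀ z ≥ z₀, ∀ᶠ s : Fin (2 * d + 1) → ℕ in atTop, ∀ᶠ T : ℕ in atTop,
      (((intBox (Fin.insertNth n T s : Fin (2 * d + 2) → ℕ)).filter fun x =>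
        ∃ p : ℕ, p.Prime ∧ z < p ∧ (p : ℤ) ^ d ∣ resEval d x).card : ℝ) ≤
        ε * (intBox (Fin.insertNth n T s : Fin (2 * d + 2) → ℕ)).card := by
  obtain ⟨U, V, Δ, hΔ, hUV⟩ := exists_mul_resSlotPoly_add_mul_derivative d n hd
  refine eventually_card_large_prime_le (2 * d) d hd n (resSlotPoly d n) U V Δ
    (fun x => resEval d x) (fun t c => ?_) (natDegree_resSlotPoly_le d n) hΔ hUV
    (fun c p hp h => exists_dvd_of_dvd_coeff_resSlotPoly d n c hp h)
    (exists_eval_coeff_resSlotPoly_ne_zero d n (by omega)) ε hε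
  rw [eval_map_resSlotPoly]
  simp

end ResultantInOneVariable

/-! ### Iterated limits -/

section IteratedLimits

/-- The filter of the boxes whose `n`-th side is large with respect to the other sides, which
themselves tend to infinity. -/
def boxFilter {m : ℕ} (n : Fin (m + 1)) : Filter (Fin (m + 1) → ℕ) :=
  (atTop : Filter (Fin m → ℕ)).bind fun s =>
    (atTop : Filter ℕ).map fun T => (Fin.insertNth n T s : Fin (m + 1) → ℕ)

variable {m : ℕ} (n : Fin (m + 1))

lemma eventually_boxFilter {q : (Fin (m + 1) → ℕ) → Prop} :
    (∀ᶠ r in boxFilter n, q r) ↔ ∀ᶠ s : Fin m → ℕ in atTop, ∀ᶠ T : ℕ in atTop,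
      q (Fin.insertNth n T s) := by
  rw [boxFilter, eventually_bind]
  rfl

lemma boxFilter_le_atTop : boxFilter n ≤ atTop := by
  refine fun A hA => ?_
  obtain ⟨b, hb⟩ := mem_atTop_sets.1 hA
  refine (eventually_boxFilter n (q := fun r => r ∈ A)).2 ?_
  filter_upwards [eventually_ge_atTop (n.removeNth b)] with s hs
  filter_upwards [eventually_ge_atTop (b n)] with T hT
  exact hb _ (Fin.le_insertNth_iff.2 ⟨hT, hs⟩)

instance boxFilter_neBot : (boxFilter n).NeBot := by
  refine ⟨fun h => ?_⟩
  have h1 : ∀ᶠ _ in boxFilter n, False := by rw [h]; exact eventually_bot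
  rw [eventually_boxFilter] at h1
  obtain ⟨s, hs⟩ := h1.exists
  exact hs.exists.elim fun _ => id

lemma liminf_and_limsup_eq_of_eventually_abs_sub_le {α β : Type*} {l : Filter α} {l' : Filter β}
    [l.NeBot] [l'.NeBot] {f : α → β → ℝ} {L : ℝ}
    (h : ∀ ε > 0, ∀ᶠ s in l, ∀ᶠ t in l', |f s t - L| ≤ ε) :
    liminf (fun s => liminf (f s) l') l = L ∧ limsup (fun s => limsup (f s) l') l = L := by
  have key : ∀ s, ∀ ε, (∀ᶠ t in l', |f s t - L| ≤ ε) →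
      |liminf (f s) l' - L| ≤ ε ∧ |limsup (f s) l' - L| ≤ ε := by
    intro s ε hs
    have h1 : ∀ᶠ t in l', L - ε ≤ f s t := hs.mono fun t ht => by linarith [(abs_le.1 ht).1]
    have h2 : ∀ᶠ t in l', f s t ≤ L + ε := hs.mono fun t ht => by linarith [(abs_le.1 ht).2]
    have b1 : IsBoundedUnder (· ≥ ·) l' (f s) := ⟨_, h1⟩
    have b2 : IsBoundedUnder (· ≤ ·) l' (f s) := ⟨_, h2⟩
    have e1 : L - ε ≤ liminf (f s) l' := le_liminf_of_le b2.isCoboundedUnder_ge h1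
    have e2 : limsup (f s) l' ≤ L + ε := limsup_le_of_le b1.isCoboundedUnder_le h2
    have e3 := liminf_le_limsup b2 b1
    constructor <;> rw [abs_le] <;> constructor <;> linarith
  constructor
  · refine Tendsto.liminf_eq (Metric.tendsto_nhds.2 fun ε hε => ?_)
    filter_upwards [h (ε / 2) (half_pos hε)] with s hs
    exact ((key s _ hs).1).trans_lt (half_lt_self hε)
  · refine Tendsto.limsup_eq (Metric.tendsto_nhds.2 fun ε hε => ?_)
    filter_upwards [h (ε / 2) (half_pos hε)] with s hs
    exact ((key s _ hs).2).trans_lt (half_lt_self hε)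

lemma tendsto_floor_removeNth :
    Tendsto (fun (s : Fin (m + 1) → ℝ) (j : Fin m) => ⌊s (n.succAbove j)⌋₊) atTop atTop := by
  refine tendsto_atTop.2 fun b => ?_
  filter_upwards [eventually_ge_atTop (Fin.insertNth n 0 fun j => (b j : ℝ) : Fin (m + 1) → ℝ)]
    with s hs j
  have := hs (n.succAbove j)
  rw [Fin.insertNth_apply_succAbove] at this
  exact Nat.le_floor this

lemma floor_update_eq (s : Fin (m + 1) → ℝ) (t : ℝ) :
    (fun i => ⌊Function.update s n t i⌋₊) =
      (Fin.insertNth n ⌊t⌋₊ fun j => ⌊s (n.succAbove j)⌋₊ : Fin (m + 1) → ℕ) := by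
  ext i
  induction i using Fin.succAboveCases n <;> simp

end IteratedLimits

/-! ### Tuples up to sign -/

section Sign

/-- The first nonzero coordinate is positive. -/
def FirstPos {m : ℕ} (x : Fin m → ℤ) : Prop := ∃ i, 0 < x i ∧ ∀ j, j < i → x j = 0

variable {m : ℕ}

lemma firstPos_neg_iff {x : Fin m → ℤ} (hx : x ≠ 0) : FirstPos (-x) ↔ ¬ FirstPos x := by
  constructor
  · rintro ⟨i, hi, hi'⟩ ⟨j, hj, hj'⟩
    rcases lt_trichotomy i j with h | rfl | h
    · simp [hj' i h] at hi
    · simp only [Pi.neg_apply] at hi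
      omega
    · have := hi' j h
      simp only [Pi.neg_apply] at this
      omega
  · intro h
    obtain ⟨i, hi⟩ := Function.ne_iff.1 hx
    obtain ⟨k, hk, hk'⟩ := WellFounded.has_min (wellFounded_lt (α := Fin m)) {i | x i ≠ 0} ⟨i, hi⟩
    have hlt : ∀ j, j < k → x j = 0 := fun j hj => by
      by_contra hne
      exact hk' j hne hj
    refine ⟨k, ?_, fun j hj => by simp [hlt j hj]⟩
    by_contra hneg
    exact h ⟨k, lt_of_le_of_ne (by simpa using hneg) (Ne.symm hk), hlt⟩

lemma mem_box_iff_mem_intBox {r : Fin m → ℝ} (hr : 0 ≤ r) {x : Fin m → ℤ} :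
    x ∈ box r ↔ x ∈ intBox fun i => ⌊r i⌋₊ := by
  rw [mem_intBox]
  refine forall_congr' fun i => ?_
  rw [← Int.cast_abs, Int.abs_eq_natAbs, Int.cast_natCast, Nat.cast_le, Nat.le_floor_iff (hr i)]

open Classical in
lemma card_firstPos_inter_box {r : Fin m → ℝ} (hr : 0 ≤ r) {G : (Fin m → ℤ) → Prop}
    (h0 : ¬ G 0) (hG : ∀ x, G (-x) ↔ G x) :
    ((intBox fun i => ⌊r i⌋₊).filter G).card =
      2 * Nat.card ↥({x | G x ∧ FirstPos x} ∩ box r) := by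
  set B := intBox fun i => ⌊r i⌋₊ with hB
  have e1 : ({x | G x ∧ FirstPos x} ∩ box r : Set (Fin m → ℤ)) =
      ((B.filter G).filter FirstPos : Finset (Fin m → ℤ)) := by
    ext x
    simp only [Set.mem_inter_iff, Set.mem_ofPred_eq, mem_box_iff_mem_intBox hr, Finset.coe_filter,
      Finset.mem_filter, ← hB]
    tauto
  have e2 : ((B.filter G).filter fun x => ¬ FirstPos x).card =
      ((B.filter G).filter FirstPos).card := by
    have hB' : ∀ x, -x ∈ B ↔ x ∈ B := fun x => by simp [hB, mem_intBox]
    refine Finset.card_nbij' (fun x => -x) (fun x => -x) ?_ ?_ ?_ ?_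
    · intro x hx
      simp only [Finset.coe_filter, Finset.mem_filter, Set.mem_ofPred_eq, hB', hG] at hx ⊢
      exact ⟨hx.1, (firstPos_neg_iff fun h => h0 (h ▸ hx.1.2)).2 hx.2⟩
    · intro x hx
      simp only [Finset.coe_filter, Finset.mem_filter, Set.mem_ofPred_eq, hB', hG] at hx ⊢
      exact ⟨hx.1, fun h => (firstPos_neg_iff fun h => h0 (h ▸ hx.1.2)).1 h hx.2⟩
    · intro x _; exact neg_neg x
    · intro x _; exact neg_neg x
  rw [e1, Nat.card_coe_set_eq, Set.ncard_coe_finset,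
    ← Finset.card_filter_add_card_filter_not (s := B.filter G) FirstPos, e2, two_mul]

lemma gcd_eq_one_iff_forall_prime {x : Fin m → ℤ} :
    Finset.univ.gcd x = 1 ↔ ∀ p : ℕ, p.Prime → ¬ ∀ i, (p : ℤ) ∣ x i := by
  constructor
  · intro h p hp hdvd
    have := Finset.dvd_gcd (s := Finset.univ) fun i _ => hdvd i
    rw [h] at this
    exact hp.one_lt.ne' (by exact_mod_cast Int.eq_one_of_dvd_one (by positivity) this)
  · intro h
    have h1 : (Finset.univ.gcd x).natAbs = 1 := by
      by_contra hne
      obtain ⟨p, hp, hpd⟩ := Nat.exists_prime_and_dvd hne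
      exact h p hp fun i => (Int.natCast_dvd.2 hpd).trans (Finset.gcd_dvd (Finset.mem_univ i))
    have h2 := Finset.normalize_gcd (s := Finset.univ) (f := x)
    rw [← h2, ← Int.abs_eq_normalize, Int.abs_eq_natAbs, h1, Nat.cast_one]

end Sign

/-! ### Densities along iterated limits -/

section Main

variable (d : ℕ) (n : Fin (2 * d + 2))

lemma resEval_modEq {x y : Fin (2 * d + 2) → ℤ} {q : ℤ} (h : ∀ i, x i ≡ y i [ZMOD q]) :
    resEval d x ≡ resEval d y [ZMOD q] := by
  refine (Int.modEq_iff_dvd.2 ?_)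
  have := dvd_eval_sub_eval q (resPoly d) y x fun i => (h i).dvd
  exact this

lemma resEval_zero (hd : d ≠ 0) : resEval d (0 : Fin (2 * d + 2) → ℤ) = 0 := by
  have h := resEval_const_mul d (0 : ℤ) 0
  rw [zero_pow (by omega), zero_mul] at h
  simp only [zero_mul] at h
  exact h

lemma resEval_neg (x : Fin (2 * d + 2) → ℤ) : resEval d (-x) = resEval d x := by
  have h := resEval_const_mul d (-1 : ℤ) x
  rw [Even.neg_one_pow (even_two_mul d), one_mul] at h
  rw [← h]
  congr 1
  ext i
  simp

lemma boxRatio_large_prime_resEval_le (hd : 2 ≤ d) {ε : ℝ} (hε : 0 < ε) :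
    ∃ z₀ : ℕ, ∀ z ≥ z₀, ∀ᶠ r in boxFilter n,
      boxRatio (fun x : Fin (2 * d + 2) → ℤ =>
        ∃ p : ℕ, p.Prime ∧ z < p ∧ (p : ℤ) ^ d ∣ resEval d x) r ≤ ε := by
  obtain ⟨z₀, hz₀⟩ := eventually_card_large_prime_resEval_le d n hd hε
  refine ⟨z₀, fun z hz => (eventually_boxFilter n).2 ?_⟩
  filter_upwards [hz₀ z hz] with s hs
  filter_upwards [hs] with T hT
  rw [boxRatio, div_le_iff₀ (card_intBox_pos _)]
  convert hT

/-- The density of tuples satisfying local conditions which, at large primes, only exclude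
resultants divisible by a `d`-th power. -/
lemma exists_tendsto_boxRatio_of_dvd_resEval (hd : 2 ≤ d)
    (Bad : ℕ → (Fin (2 * d + 2) → ℤ) → Prop)
    (hper : ∀ p x y, (∀ i, x i ≡ y i [ZMOD (p ^ d : ℕ)]) → Bad p x → Bad p y) (w : ℕ)
    (hlarge : ∀ p x, w < p → Bad p x → (p : ℤ) ^ d ∣ resEval d x)
    (hsmall : ∀ p x, Bad p x → (p : ℤ) ∣ resEval d x) :
    ∃ L : ℝ, 0 < L ∧
      Tendsto (boxRatio fun x => ∀ p : ℕ, p.Prime → ¬ Bad p x) (boxFilter n) (nhds L) := by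
  refine exists_tendsto_boxRatio _ (boxFilter_le_atTop n) Bad d hper (fun ε hε => ?_) ?_
  · obtain ⟨z₀, hz₀⟩ := boxRatio_large_prime_resEval_le d n hd hε
    refine ⟨max z₀ w, fun z hz => (hz₀ z (le_of_max_le_left hz)).mono fun r hr => ?_⟩
    refine (boxRatio_mono (fun x => ?_) r).trans hr
    rintro ⟨p, hp, hzp, hbad⟩
    exact ⟨p, hp, hzp, hlarge p x ((le_of_max_le_right hz).trans_lt hzp) hbad⟩
  · obtain ⟨Q, -, hQ⟩ := exists_isUnit_resEval d (by omega) 0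
    exact ⟨Q, fun p hp hbad =>
      (Nat.prime_iff_prime_int.1 hp).not_isUnit (isUnit_of_dvd_unit (hsmall p Q hbad) hQ)⟩

lemma exists_tendsto_boxRatio_good (hd : 2 ≤ d) (Sig : Finset ℕ) (hSig : ∀ p ∈ Sig, Nat.Prime p) :
    ∃ L : ℝ, 0 < L ∧ Tendsto (boxRatio fun x : Fin (2 * d + 2) → ℤ =>
      (∀ p ∈ Sig, ¬ (p : ℤ) ∣ resEval d x) ∧
        ∀ p : ℕ, p.Prime → ¬ (p : ℤ) ^ d ∣ resEval d x) (boxFilter n) (nhds L) := by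
  have hd0 : d ≠ 0 := by omega
  let Bad : ℕ → (Fin (2 * d + 2) → ℤ) → Prop := fun p x =>
    (p ∈ Sig ∧ (p : ℤ) ∣ resEval d x) ∨ (p : ℤ) ^ d ∣ resEval d x
  have hper : ∀ p x y, (∀ i, x i ≡ y i [ZMOD (p ^ d : ℕ)]) → Bad p x → Bad p y := by
    intro p x y hxy h
    have hmod := resEval_modEq d hxy
    push_cast at hmod
    refine h.imp (And.imp_right fun h => ?_) fun h => ?_
    · exact (Int.ModEq.dvd_iff (hmod.of_dvd (dvd_pow_self _ hd0))).1 h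
    · exact (Int.ModEq.dvd_iff hmod).1 h
  have hlarge : ∀ p x, Sig.sup id < p → Bad p x → (p : ℤ) ^ d ∣ resEval d x := by
    rintro p x hp (h | h)
    · exact absurd (Finset.le_sup (f := id) h.1) (not_le.2 hp)
    · exact h
  have hsmall : ∀ p x, Bad p x → (p : ℤ) ∣ resEval d x := by
    rintro p x (h | h)
    · exact h.2
    · exact (dvd_pow_self _ hd0).trans h
  obtain ⟨L, hL, hlim⟩ :=
    exists_tendsto_boxRatio_of_dvd_resEval d n hd Bad hper (Sig.sup id) hlarge hsmall
  refine ⟨L, hL, ?_⟩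
  convert hlim using 3 with x
  constructor
  · rintro ⟨h1, h2⟩ p hp (h | h)
    exacts [h1 p h.1 h.2, h2 p hp h]
  · exact fun h => ⟨fun p hp hdvd => h p (hSig p hp) (Or.inl ⟨hp, hdvd⟩),
      fun p hp hdvd => h p hp (Or.inr hdvd)⟩

lemma pow_dvd_resEval_of_forall_dvd {p : ℕ} {x : Fin (2 * d + 2) → ℤ}
    (h : ∀ i, (p : ℤ) ∣ x i) : (p : ℤ) ^ d ∣ resEval d x := by
  choose y hy using h
  rw [funext hy, resEval_const_mul]
  exact (pow_dvd_pow _ (by omega)).mul_right _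

lemma exists_tendsto_boxRatio_primitive (hd : 2 ≤ d) :
    ∃ L : ℝ, 0 < L ∧ Tendsto (boxRatio fun x : Fin (2 * d + 2) → ℤ => Finset.univ.gcd x = 1)
      (boxFilter n) (nhds L) := by
  have hd0 : d ≠ 0 := by omega
  have hper : ∀ (p : ℕ) (x y : Fin (2 * d + 2) → ℤ), (∀ i, x i ≡ y i [ZMOD (p ^ d : ℕ)]) →
      (∀ i, (p : ℤ) ∣ x i) → ∀ i, (p : ℤ) ∣ y i := by
    intro p x y hxy h i
    have hmod := hxy i
    push_cast at hmod
    exact (Int.ModEq.dvd_iff (hmod.of_dvd (dvd_pow_self _ hd0))).1 (h i)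
  obtain ⟨L, hL, hlim⟩ := exists_tendsto_boxRatio_of_dvd_resEval d n hd
    (fun p x => ∀ i, (p : ℤ) ∣ x i) hper 0 (fun p x _ => pow_dvd_resEval_of_forall_dvd d)
    fun p x h => (dvd_pow_self _ hd0).trans (pow_dvd_resEval_of_forall_dvd d h)
  refine ⟨L, hL, ?_⟩
  simpa only [gcd_eq_one_iff_forall_prime] using hlim

lemma weakRatio_eq_boxRatio_div (hd : 2 ≤ d) (Sig : Finset ℕ) {r : Fin (2 * d + 2) → ℝ}
    (hr : 0 ≤ r) : weakRatio d (VSigma d Sig) r =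
      boxRatio (fun x : Fin (2 * d + 2) → ℤ => (∀ p ∈ Sig, ¬ (p : ℤ) ∣ resEval d x) ∧
        ∀ p : ℕ, p.Prime → ¬ (p : ℤ) ^ d ∣ resEval d x) (fun i => ⌊r i⌋₊) /
      boxRatio (fun x : Fin (2 * d + 2) → ℤ => Finset.univ.gcd x = 1) fun i => ⌊r i⌋₊ := by
  classical
  have hd0 : d ≠ 0 := by omega
  have hgcd : ∀ x : Fin (2 * d + 2) → ℤ, (∀ p : ℕ, p.Prime → ¬ (p : ℤ) ^ d ∣ resEval d x) →
      Finset.univ.gcd x = 1 := by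
    exact fun x hx => gcd_eq_one_iff_forall_prime.2 fun p hp h =>
      hx p hp (pow_dvd_resEval_of_forall_dvd d h)
  have hV : VSigma d Sig = {x | ((∀ p ∈ Sig, ¬ (p : ℤ) ∣ resEval d x) ∧
      ∀ p : ℕ, p.Prime → ¬ (p : ℤ) ^ d ∣ resEval d x) ∧ FirstPos x} := by
    ext x
    constructor
    · exact fun h => ⟨h.2, h.1.2⟩
    · exact fun h => ⟨⟨hgcd x h.1.2, h.2⟩, h.1⟩
  have hP : projPts d = {x | Finset.univ.gcd x = 1 ∧ FirstPos x} := rfl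
  have h1 := card_firstPos_inter_box hr (G := fun x : Fin (2 * d + 2) → ℤ =>
    (∀ p ∈ Sig, ¬ (p : ℤ) ∣ resEval d x) ∧ ∀ p : ℕ, p.Prime → ¬ (p : ℤ) ^ d ∣ resEval d x)
    (fun h => h.2 2 Nat.prime_two (by rw [resEval_zero d hd0]; exact dvd_zero _))
    (fun x => by rw [resEval_neg])
  have h2 := card_firstPos_inter_box hr (G := fun x : Fin (2 * d + 2) → ℤ =>
    Finset.univ.gcd x = 1)
    (fun h => gcd_eq_one_iff_forall_prime.1 h 2 Nat.prime_two fun i => dvd_zero _)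
    (fun x => by simp only [gcd_eq_one_iff_forall_prime, Pi.neg_apply, dvd_neg])
  rw [weakRatio, hV, hP, boxRatio, boxRatio, div_div_div_cancel_right₀ (card_intBox_pos _).ne', h1,
    h2]
  push_cast
  rw [mul_div_mul_left _ _ two_ne_zero]

end Main

/-- the `n`-th weak box density of `V_Σ` exists and is strictly positive. -/
theorem stmt_15 (d : ℕ) (hd : 2 ≤ d) (n : Fin (2 * d + 2)) (Sig : Finset ℕ)
    (hSig : ∀ p ∈ Sig, Nat.Prime p) :
    ∃ L : ℝ, 0 < L ∧
      liminf (fun s : Fin (2 * d + 2) → ℝ =>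
          liminf (fun t : ℝ => weakRatio d (VSigma d Sig) (Function.update s n t)) atTop)
        atTop = L ∧
      limsup (fun s : Fin (2 * d + 2) → ℝ =>
          limsup (fun t : ℝ => weakRatio d (VSigma d Sig) (Function.update s n t)) atTop)
        atTop = L := by
  obtain ⟨L₁, hL₁, h₁⟩ := exists_tendsto_boxRatio_good d n hd Sig hSig
  obtain ⟨L₂, hL₂, h₂⟩ := exists_tendsto_boxRatio_primitive d n hd
  refine ⟨L₁ / L₂, div_pos hL₁ hL₂, liminf_and_limsup_eq_of_eventually_abs_sub_le fun ε hε => ?_⟩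
  have h := (eventually_boxFilter n).1 ((Metric.tendsto_nhds.1 (h₁.div h₂ hL₂.ne')) ε hε)
  filter_upwards [(tendsto_floor_removeNth n).eventually h, eventually_ge_atTop 0] with s hs hs0
  filter_upwards [tendsto_nat_floor_atTop.eventually hs, eventually_ge_atTop 0] with t ht ht0
  have hr : 0 ≤ Function.update s n t := fun i => by
    rcases eq_or_ne i n with rfl | hi
    · simpa using ht0
    · simpa [hi] using hs0 i
  rw [weakRatio_eq_boxRatio_div d hd Sig hr, floor_update_eq]
  exact (Real.dist_eq _ _ ▸ ht).le
end
end

section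
/- Let p be a prime and let R := a²f² − abef − 2acdf + ace² + b²df − bcde + c²d² ∈ 𝔽_p[a,b,c,d,e,f] (the resultant of the binary quadratic forms aX² + bXY + cY² and dX² + eXY + fY²). Then the number of points (a,b,c,d,e,f) ∈ 𝔽_p^6 with R(a,b,c,d,e,f) = 0 is at most 2p⁵ − p³. -/
open Filter MvPolynomial

noncomputable section

section CountingZeros

variable {F : Type*} [Field F]

/-- The resultant of the binary quadratic forms with coefficients `v 0, v 1, v 2` and
`v 3, v 4, v 5`. -/
def quadResultant (v : Fin 6 → F) : F :=
  (v 0) ^ 2 * (v 5) ^ 2 - v 0 * v 1 * v 4 * v 5 - 2 * (v 0 * v 2 * v 3 * v 5) +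
    v 0 * v 2 * (v 4) ^ 2 + (v 1) ^ 2 * v 3 * v 5 - v 1 * v 2 * v 3 * v 4 +
    (v 2) ^ 2 * (v 3) ^ 2

/-- A quadratic equation with nonzero leading coefficient has no three distinct roots. -/
lemma eq_of_three_quadratic_roots {A B C x y z : F} (hA : A ≠ 0)
    (hx : A * x ^ 2 + B * x + C = 0) (hy : A * y ^ 2 + B * y + C = 0)
    (hz : A * z ^ 2 + B * z + C = 0) (hxy : x ≠ y) (hxz : x ≠ z) : y = z := by
  have h₁ : A * (x + y) + B = 0 :=
    mul_left_cancel₀ (sub_ne_zero.2 hxy) (by linear_combination hx - hy)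
  have h₂ : A * (x + z) + B = 0 :=
    mul_left_cancel₀ (sub_ne_zero.2 hxz) (by linear_combination hx - hz)
  exact mul_left_cancel₀ hA (by linear_combination h₁ - h₂)

variable [Fintype F] [DecidableEq F]

lemma card_filter_ne_zero :
    (Finset.univ.filter fun x : F => x ≠ 0).card = Fintype.card F - 1 := by
  rw [Finset.filter_ne', Finset.card_erase_of_mem (Finset.mem_univ _), Finset.card_univ]

lemma card_zeros_of_lead_ne_zero :
    (Finset.univ.filter fun v : Fin 6 → F => quadResultant v = 0 ∧ v 0 ≠ 0).card ≤
      2 * ((Fintype.card F - 1) * Fintype.card F ^ 4) := by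
  refine (Finset.card_le_mul_card_image_of_maps_to
    (f := fun v : Fin 6 → F => (v 0, v 1, v 2, v 3, v 4))
    (t := (Finset.univ.filter fun x : F => x ≠ 0) ×ˢ Finset.univ) (fun v hv => ?_) 2
    (fun w _ => ?_)).trans (le_of_eq ?_)
  · simpa using (Finset.mem_filter.1 hv).2.2
  · by_contra! hcard
    obtain ⟨x, hx, y, hy, z, hz, hxy, hxz, hyz⟩ := Finset.two_lt_card.1 hcard
    obtain ⟨a, b, c, d, e⟩ := w
    simp only [Finset.mem_filter, Finset.mem_univ, true_and, Prod.mk.injEq] at hx hy hz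
    simp only [quadResultant] at hx hy hz
    obtain ⟨⟨rx, ha⟩, x0, x1, x2, x3, x4⟩ := hx
    obtain ⟨⟨ry, -⟩, y0, y1, y2, y3, y4⟩ := hy
    obtain ⟨⟨rz, -⟩, z0, z1, z2, z3, z4⟩ := hz
    rw [x0, x1, x2, x3, x4] at rx
    rw [y0, y1, y2, y3, y4] at ry
    rw [z0, z1, z2, z3, z4] at rz
    rw [x0] at ha
    have last_ne : ∀ u v : Fin 6 → F, u ≠ v → u 0 = v 0 → u 1 = v 1 → u 2 = v 2 →
        u 3 = v 3 → u 4 = v 4 → u 5 ≠ v 5 := by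
      intro u v huv h0 h1 h2 h3 h4 h5
      exact huv (funext fun i => by fin_cases i <;> assumption)
    refine last_ne y z hyz (y0.trans z0.symm) (y1.trans z1.symm) (y2.trans z2.symm)
      (y3.trans z3.symm) (y4.trans z4.symm) ?_
    refine eq_of_three_quadratic_roots (A := a ^ 2)
      (B := -a * b * e - 2 * a * c * d + b ^ 2 * d)
      (C := a * c * e ^ 2 - b * c * d * e + c ^ 2 * d ^ 2) (x := x 5) (pow_ne_zero 2 ha)
      (by linear_combination rx) (by linear_combination ry) (by linear_combination rz)
      (last_ne x y hxy (x0.trans y0.symm) (x1.trans y1.symm) (x2.trans y2.symm)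
        (x3.trans y3.symm) (x4.trans y4.symm))
      (last_ne x z hxz (x0.trans z0.symm) (x1.trans z1.symm) (x2.trans z2.symm)
        (x3.trans z3.symm) (x4.trans z4.symm))
  · rw [Finset.card_product, card_filter_ne_zero, Finset.card_univ]
    simp only [Fintype.card_prod]
    ring

lemma card_both_leads_zero :
    (Finset.univ.filter fun v : Fin 6 → F => v 0 = 0 ∧ v 3 = 0).card ≤ Fintype.card F ^ 4 := by
  refine (Finset.card_le_card_of_injOn (fun v : Fin 6 → F => (v 1, v 2, v 4, v 5))
    (t := Finset.univ) (fun _ _ => by simp) (fun u hu v hv huv => ?_)).trans (le_of_eq ?_)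
  · simp only [Finset.coe_filter, Finset.mem_univ, true_and, Set.mem_ofPred_eq] at hu hv
    simp only [Prod.mk.injEq] at huv
    obtain ⟨h1, h2, h4, h5⟩ := huv
    have h0 : u 0 = v 0 := hu.1.trans hv.1.symm
    have h3 : u 3 = v 3 := hu.2.trans hv.2.symm
    exact funext fun i => by fin_cases i <;> assumption
  · simp only [Finset.card_univ, Fintype.card_prod]
    ring

lemma card_zeros_of_fst_lead_zero :
    (Finset.univ.filter fun v : Fin 6 → F =>
      quadResultant v = 0 ∧ v 0 = 0 ∧ v 3 ≠ 0).card ≤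
      (Fintype.card F - 1) * Fintype.card F ^ 3 := by
  refine (Finset.card_le_card_of_injOn
    (fun v : Fin 6 → F => (v 3, v 1, v 4, if v 1 = 0 then v 5 else v 2))
    (t := (Finset.univ.filter fun x : F => x ≠ 0) ×ˢ Finset.univ)
    (fun v hv => ?_) (fun u hu v hv huv => ?_)).trans (le_of_eq ?_)
  · simpa using (Finset.mem_filter.1 hv).2.2.2
  · simp only [Finset.coe_filter, Finset.mem_univ, true_and, Set.mem_ofPred_eq] at hu hv
    simp only [quadResultant] at hu hv
    simp only [Prod.mk.injEq] at huv
    obtain ⟨ru, u0, u3⟩ := hu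
    obtain ⟨rv, v0, v3⟩ := hv
    obtain ⟨h3, h1, h4, h⟩ := huv
    have h0 : u 0 = v 0 := u0.trans v0.symm
    have h25 : u 2 = v 2 ∧ u 5 = v 5 := by
      by_cases hb : v 1 = 0
      · simp only [h1, hb, if_true] at h
        simp only [u0, h1, hb] at ru
        simp only [v0, hb] at rv
        have hu2 : u 2 = 0 := by simpa [u3] using ru
        have hv2 : v 2 = 0 := by simpa [v3] using rv
        exact ⟨hu2.trans hv2.symm, h⟩
      · simp only [h1, hb, if_false] at h
        refine ⟨h, mul_left_cancel₀ (mul_ne_zero (pow_ne_zero 2 hb) v3) ?_⟩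
        rw [u0, h1, h, h3, h4] at ru
        rw [v0] at rv
        linear_combination ru - rv
    obtain ⟨h2, h5⟩ := h25
    exact funext fun i => by fin_cases i <;> assumption
  · rw [Finset.card_product, card_filter_ne_zero, Finset.card_univ]
    simp only [Fintype.card_prod]
    ring

lemma card_zeros_quadResultant_le :
    (Finset.univ.filter fun v : Fin 6 → F => quadResultant v = 0).card ≤
      2 * Fintype.card F ^ 5 - Fintype.card F ^ 3 := by
  have hsub : (Finset.univ.filter fun v : Fin 6 → F => quadResultant v = 0) ⊆
      (Finset.univ.filter fun v : Fin 6 → F => quadResultant v = 0 ∧ v 0 ≠ 0) ∪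
      ((Finset.univ.filter fun v : Fin 6 → F => v 0 = 0 ∧ v 3 = 0) ∪
      (Finset.univ.filter fun v : Fin 6 → F => quadResultant v = 0 ∧ v 0 = 0 ∧ v 3 ≠ 0)) := by
    intro v hv
    simp only [Finset.mem_filter, Finset.mem_union, Finset.mem_univ, true_and] at hv ⊢
    tauto
  refine ((Finset.card_le_card hsub).trans ((Finset.card_union_le _ _).trans (add_le_add
    card_zeros_of_lead_ne_zero ((Finset.card_union_le _ _).trans (add_le_add
      card_both_leads_zero card_zeros_of_fst_lead_zero))))).trans (Nat.le_sub_of_add_le ?_)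
  obtain ⟨n, hn⟩ := Nat.exists_eq_add_of_lt (Fintype.card_pos (α := F))
  rw [hn]
  simp only [Nat.zero_add, Nat.add_sub_cancel]
  exact le_of_eq (by ring)

end CountingZeros

/-- the resultant of two generic binary quadratic forms has at most
`2p⁵ − p³` zeros over `𝔽_p`. -/
theorem stmt_17 (p : ℕ) (hp : p.Prime) :
    Nat.card {v : Fin 6 → ZMod p //
        (v 0) ^ 2 * (v 5) ^ 2 - v 0 * v 1 * v 4 * v 5 - 2 * (v 0 * v 2 * v 3 * v 5) +
            v 0 * v 2 * (v 4) ^ 2 + (v 1) ^ 2 * v 3 * v 5 - v 1 * v 2 * v 3 * v 4 +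
            (v 2) ^ 2 * (v 3) ^ 2 = 0} ≤
      2 * p ^ 5 - p ^ 3 := by
  have : Fact p.Prime := ⟨hp⟩
  change Nat.card {v : Fin 6 → ZMod p // quadResultant v = 0} ≤ _
  rw [Nat.card_eq_fintype_card, Fintype.card_subtype]
  simpa only [ZMod.card] using card_zeros_quadResultant_le (F := ZMod p)
end
end
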